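/- Let A : Σ → SL₂(ℝ) be continuous. If A is not uniformly hyperbolic and L(A) > 0, then for every ε > 0 there exists a continuous map B : Σ → SL₂(ℝ) with sup_{x∈Σ} ‖A(x) − B(x)‖ < ε and L(B) = 0. (Bochi–Mañé theorem.) -/

import Mathlib

open MeasureTheory

noncomputable section

abbrev Mat2 : Type := Matrix (Fin 2) (Fin 2) ℝ
abbrev SL2 : Type := Matrix.SpecialLinearGroup (Fin 2) ℝ
abbrev E2 : Type := EuclideanSpace ℝ (Fin 2)
abbrev Pone : Type := Projectivization ℝ E2

instance : TopologicalSpace SL2 :=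
  inferInstanceAs (TopologicalSpace { A : Mat2 // A.det = 1 })

/-- The operator norm of a 2×2 real matrix, acting on Euclidean ℝ². -/
def opNorm (M : Mat2) : ℝ := ‖Matrix.toEuclideanCLM (𝕜 := ℝ) M‖

/-- The continuous linear map on Euclidean ℝ² induced by a matrix in SL₂(ℝ). -/
def toEuc (g : SL2) : E2 →L[ℝ] E2 := Matrix.toEuclideanCLM (𝕜 := ℝ) (g : Mat2)

lemma toEuc_injective (g : SL2) : Function.Injective (toEuc g) := by
  intro x y hxy
  have key : ∀ z, toEuc g⁻¹ (toEuc g z) = z := by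
    intro z
    have h1 : ((g⁻¹ : SL2) : Mat2) * (g : Mat2) = 1 := by
      rw [← Matrix.SpecialLinearGroup.coe_mul, inv_mul_cancel,
        Matrix.SpecialLinearGroup.coe_one]
    calc toEuc g⁻¹ (toEuc g z)
        = (Matrix.toEuclideanCLM (𝕜 := ℝ) (((g⁻¹ : SL2) : Mat2) * (g : Mat2))) z := by
          rw [map_mul]; rfl
      _ = z := by rw [h1, map_one]; rfl
  have := congrArg (toEuc g⁻¹) hxy
  rwa [key, key] at this

/-- The projective action of SL₂(ℝ) on the real projective line ℙ¹. -/
def pact (g : SL2) : Pone → Pone :=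
  Projectivization.map (toEuc g).toLinearMap (toEuc_injective g)

instance : MeasurableSpace Pone :=
  inferInstanceAs (MeasurableSpace (Quotient (projectivizationSetoid ℝ E2)))

instance : TopologicalSpace Pone :=
  inferInstanceAs (TopologicalSpace (Quotient (projectivizationSetoid ℝ E2)))

/-- The space `Σ = {1,…,κ}^ℤ` of bilateral sequences in `κ` symbols. -/
abbrev Sig (κ : ℕ) : Type := ℤ → Fin κ

/-- The left shift map `σ((x_n)_n) = (x_{n+1})_n`. -/
def shift {κ : ℕ} (x : Sig κ) : Sig κ := fun n => x (n + 1)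

/-- The cocycle iterates: `A^n(x) = A(σ^{n-1}x) ⋯ A(σ x) A(x)`. -/
def cocycleN {κ : ℕ} (A : Sig κ → SL2) : ℕ → Sig κ → SL2
  | 0, _ => 1
  | n + 1, x => cocycleN A n (shift x) * A x

/-- `μ` is the Bernoulli measure `p^ℤ` on `Σ`: a probability measure giving each
cylinder its product measure. -/
def IsBernoulli {κ : ℕ} (p : Fin κ → ℝ) (μ : Measure (Sig κ)) : Prop :=
  IsProbabilityMeasure μ ∧
    ∀ (s : Finset ℤ) (a : ℤ → Fin κ),
      μ {x | ∀ n ∈ s, x n = a n} = ∏ n ∈ s, ENNReal.ofReal (p (a n))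

/-- The Lyapunov exponent `L(A) = inf_{n ≥ 1} (1/n) ∫_Σ log‖A^n(x)‖ dμ(x)`. -/
def lyap {κ : ℕ} (μ : Measure (Sig κ)) (A : Sig κ → SL2) : ℝ :=
  ⨅ n : {m : ℕ // 0 < m},
    (((n : ℕ) : ℝ))⁻¹ * ∫ x, Real.log (opNorm ((cocycleN A (n : ℕ) x : SL2) : Mat2)) ∂μ

/-- A continuous cocycle `A : Σ → SL₂(ℝ)` is uniformly hyperbolic: there are continuous
invariant stable/unstable sections `ê^s, ê^u : Σ → ℙ¹` along which the iterates of the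
cocycle contract (resp. the iterates of the inverse contract) uniformly exponentially. -/
def UniformlyHyperbolic {κ : ℕ} (A : Sig κ → SL2) : Prop :=
  ∃ es eu : Sig κ → Pone, Continuous es ∧ Continuous eu ∧
    (∀ x, pact (A x) (es x) = es (shift x)) ∧
    (∀ x, pact (A x) (eu x) = eu (shift x)) ∧
    ∃ C : ℝ, 0 < C ∧ ∃ lam : ℝ, 0 < lam ∧ ∀ (x : Sig κ) (n : ℕ), 1 ≤ n →
      (∀ v : E2, v ∈ (es x).submodule →
        ‖toEuc (cocycleN A n x) v‖ ≤ C * Real.exp (-lam * n) * ‖v‖) ∧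
      (∀ w : E2, w ∈ (eu (shift^[n] x)).submodule →
        ‖toEuc (cocycleN A n x)⁻¹ w‖ ≤ C * Real.exp (-lam * n) * ‖w‖)

/-! ### Linear algebra in `SL₂(ℝ)` -/

lemma toEuc_mul (g h : SL2) : toEuc (g * h) = toEuc g * toEuc h := by
  simp [toEuc, map_mul]

lemma toEuc_mul_apply (g h : SL2) (v : E2) : toEuc (g * h) v = toEuc g (toEuc h v) := by
  rw [toEuc_mul]; rfl

lemma toEuc_one : toEuc 1 = 1 := by
  simp [toEuc]

lemma toEuc_inv_apply (g : SL2) (v : E2) : toEuc g⁻¹ (toEuc g v) = v := by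
  rw [← toEuc_mul_apply, inv_mul_cancel, toEuc_one]; rfl

lemma toEuc_apply_inv (g : SL2) (v : E2) : toEuc g (toEuc g⁻¹ v) = v := by
  rw [← toEuc_mul_apply, mul_inv_cancel, toEuc_one]; rfl

lemma toEuc_zero_coord (g : SL2) (v : E2) :
    toEuc g v 0 = (g : Mat2) 0 0 * v 0 + (g : Mat2) 0 1 * v 1 := by
  have : toEuc g v 0 = ((g : Mat2).mulVec (WithLp.ofLp v)) 0 := rfl
  rw [this]; simp [Matrix.mulVec, dotProduct, Fin.sum_univ_two]

lemma toEuc_one_coord (g : SL2) (v : E2) :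
    toEuc g v 1 = (g : Mat2) 1 0 * v 0 + (g : Mat2) 1 1 * v 1 := by
  have : toEuc g v 1 = ((g : Mat2).mulVec (WithLp.ofLp v)) 1 := rfl
  rw [this]; simp [Matrix.mulVec, dotProduct, Fin.sum_univ_two]

lemma norm_sq_E2 (v : E2) : ‖v‖ ^ 2 = v 0 ^ 2 + v 1 ^ 2 := by
  rw [EuclideanSpace.real_norm_sq_eq, Fin.sum_univ_two]

lemma SL2_det (g : SL2) : (g : Mat2) 0 0 * (g : Mat2) 1 1 - (g : Mat2) 0 1 * (g : Mat2) 1 0 = 1 := by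
  have := g.det_coe
  rwa [Matrix.det_fin_two] at this

/-- The area form on the plane. -/
def wdg (u v : E2) : ℝ := u 0 * v 1 - u 1 * v 0

/-- Rotation by a right angle. -/
def Jr (v : E2) : E2 := !₂[- v 1, v 0]

lemma Jr_zero (v : E2) : Jr v 0 = - v 1 := by simp [Jr]
lemma Jr_one (v : E2) : Jr v 1 = v 0 := by simp [Jr]

lemma norm_Jr (v : E2) : ‖Jr v‖ = ‖v‖ := by
  have h : ‖Jr v‖ ^ 2 = ‖v‖ ^ 2 := by
    rw [norm_sq_E2, norm_sq_E2, Jr_zero, Jr_one]; ring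
  exact (sq_eq_sq₀ (norm_nonneg _) (norm_nonneg _)).1 h

lemma wdg_Jr (v : E2) : wdg v (Jr v) = ‖v‖ ^ 2 := by
  rw [norm_sq_E2, wdg, Jr_zero, Jr_one]; ring

lemma wdg_map (g : SL2) (u v : E2) : wdg (toEuc g u) (toEuc g v) = wdg u v := by
  have := SL2_det g
  simp only [wdg, toEuc_zero_coord, toEuc_one_coord]
  linear_combination (u 0 * v 1 - u 1 * v 0) * this

lemma abs_wdg_le (u v : E2) : |wdg u v| ≤ ‖u‖ * ‖v‖ := by
  apply abs_le_of_sq_le_sq _ (by positivity)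
  rw [mul_pow, norm_sq_E2, norm_sq_E2, wdg]
  nlinarith [sq_nonneg (u 0 * v 0 + u 1 * v 1)]

lemma wdg_triangle (a b c : E2) (hb : ‖b‖ = 1) :
    |wdg a c| ≤ |wdg a b| * ‖c‖ + ‖a‖ * |wdg b c| := by
  have hb2 := norm_sq_E2 b
  rw [hb] at hb2
  have h : wdg a c = wdg a b * (b 0 * c 0 + b 1 * c 1) + (a 0 * b 0 + a 1 * b 1) * wdg b c := by
    simp only [wdg]; linear_combination (a 0 * c 1 - a 1 * c 0) * hb2
  have cs : ∀ u v : E2, |u 0 * v 0 + u 1 * v 1| ≤ ‖u‖ * ‖v‖ := by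
    intro u v
    apply abs_le_of_sq_le_sq _ (by positivity)
    rw [mul_pow, norm_sq_E2, norm_sq_E2]
    nlinarith [sq_nonneg (u 0 * v 1 - u 1 * v 0)]
  rw [h]
  refine (abs_add_le _ _).trans ?_
  rw [abs_mul, abs_mul]
  have h1 := cs b c
  have h2 := cs a b
  rw [hb] at h1 h2
  rw [one_mul] at h1; rw [mul_one] at h2
  gcongr

lemma wdg_comm (u v : E2) : wdg u v = - wdg v u := by simp only [wdg]; ring

lemma wdg_smul_right (c : ℝ) (u v : E2) : wdg u (c • v) = c * wdg u v := by
  simp only [wdg, PiLp.smul_apply, smul_eq_mul]; ring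

/-- Decomposition in the orthonormal frame `e, Jr e`. -/
lemma decomp (e v : E2) (he : ‖e‖ = 1) :
    v = (e 0 * v 0 + e 1 * v 1) • e + (wdg e v) • Jr e := by
  have he2 := norm_sq_E2 e
  rw [he] at he2
  ext i
  fin_cases i
  · simp only [PiLp.add_apply, PiLp.smul_apply, smul_eq_mul, wdg, Fin.zero_eta, Jr_zero]
    linear_combination (v 0) * he2
  · simp only [PiLp.add_apply, PiLp.smul_apply, smul_eq_mul, wdg, Fin.mk_one, Jr_one]
    linear_combination (v 1) * he2

lemma parallel_of_wdg (e v : E2) (he : ‖e‖ = 1) (h : wdg e v = 0) : ∃ c : ℝ, v = c • e := by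
  refine ⟨e 0 * v 0 + e 1 * v 1, ?_⟩
  have := decomp e v he
  rw [h, zero_smul, add_zero] at this
  exact this

lemma abs_dot_le (e v : E2) (he : ‖e‖ = 1) : |e 0 * v 0 + e 1 * v 1| ≤ ‖v‖ := by
  have he2 := norm_sq_E2 e
  rw [he] at he2
  apply abs_le_of_sq_le_sq _ (by positivity)
  rw [norm_sq_E2]
  nlinarith [sq_nonneg (e 0 * v 1 - e 1 * v 0)]

lemma norm_inv_le (g : SL2) : ‖toEuc g⁻¹‖ ≤ ‖toEuc g‖ := by
  refine ContinuousLinearMap.opNorm_le_bound _ (norm_nonneg _) fun u => ?_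
  set w := toEuc g⁻¹ u with hw
  have hu : toEuc g w = u := by rw [hw, toEuc_apply_inv]
  have h1 : ‖w‖ ^ 2 ≤ ‖u‖ * (‖toEuc g‖ * ‖w‖) := by
    rw [← wdg_Jr, ← wdg_map g, hu]
    refine (le_abs_self _).trans ((abs_wdg_le _ _).trans ?_)
    have := (toEuc g).le_opNorm (Jr w)
    rw [norm_Jr] at this
    gcongr
  rcases (norm_nonneg w).eq_or_lt with h0 | h0
  · rw [← h0]; positivity
  · nlinarith

lemma norm_inv_eq (g : SL2) : ‖toEuc g⁻¹‖ = ‖toEuc g‖ :=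
  le_antisymm (norm_inv_le g) (by simpa using norm_inv_le g⁻¹)

lemma one_le_norm (g : SL2) : 1 ≤ ‖toEuc g‖ := by
  have h : ‖toEuc (g * g⁻¹)‖ ≤ ‖toEuc g‖ * ‖toEuc g⁻¹‖ := by
    rw [toEuc_mul]; exact norm_mul_le _ _
  rw [mul_inv_cancel, toEuc_one, norm_inv_eq, norm_one] at h
  nlinarith [norm_nonneg (toEuc g)]

lemma npos (g : SL2) : 0 < ‖toEuc g‖ := lt_of_lt_of_le one_pos (one_le_norm g)

lemma nmul_le (g h : SL2) : ‖toEuc (g * h)‖ ≤ ‖toEuc g‖ * ‖toEuc h‖ := by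
  rw [toEuc_mul]; exact norm_mul_le _ _

lemma exists_norm_attained (g : SL2) : ∃ u : E2, ‖u‖ = 1 ∧ ‖toEuc g u‖ = ‖toEuc g‖ := by
  have hne : (Metric.sphere (0 : E2) 1).Nonempty := ⟨!₂[1, 0], by
    simp [EuclideanSpace.norm_eq]⟩
  obtain ⟨u, hu, hmax⟩ := (isCompact_sphere (0 : E2) 1).exists_isMaxOn hne
    (f := fun u => ‖toEuc g u‖) (by fun_prop)
  have hu1 : ‖u‖ = 1 := by simpa using hu
  refine ⟨u, hu1, le_antisymm ?_ ?_⟩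
  · simpa [hu1] using (toEuc g).le_opNorm u
  · refine ContinuousLinearMap.opNorm_le_bound _ (norm_nonneg _) fun v => ?_
    rcases eq_or_ne v 0 with rfl | hv
    · simp
    · have hv' : 0 < ‖v‖ := norm_pos_iff.2 hv
      have h := hmax (show (‖v‖⁻¹ • v) ∈ Metric.sphere (0 : E2) 1 by
        simp [norm_smul, hv'.ne'])
      simp only [Set.mem_ofPred_eq, map_smul, norm_smul, norm_inv, norm_norm] at h
      rwa [inv_mul_le_iff₀ hv', mul_comm] at h

/-- A most contracted unit vector. -/
lemma exists_contracted (g : SL2) : ∃ v : E2, ‖v‖ = 1 ∧ ‖toEuc g v‖ = ‖toEuc g‖⁻¹ := by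
  obtain ⟨u, hu, hn⟩ := exists_norm_attained g⁻¹
  rw [norm_inv_eq] at hn
  have hp := npos g
  refine ⟨‖toEuc g‖⁻¹ • toEuc g⁻¹ u, ?_, ?_⟩
  · rw [norm_smul, hn, norm_inv, norm_norm, inv_mul_cancel₀ hp.ne']
  · rw [map_smul, toEuc_apply_inv, norm_smul, hu, norm_inv, norm_norm, mul_one]

/-- Rotation matrices. -/
def rot (t : ℝ) : SL2 :=
  ⟨!![Real.cos t, -Real.sin t; Real.sin t, Real.cos t], by
    rw [Matrix.det_fin_two_of]; nlinarith [Real.sin_sq_add_cos_sq t]⟩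

lemma rot_add (s t : ℝ) : rot (s + t) = rot s * rot t := by
  ext i j
  rw [Matrix.SpecialLinearGroup.coe_mul]
  fin_cases i <;> fin_cases j <;>
    simp [rot, Real.cos_add, Real.sin_add, Matrix.mul_apply, Fin.sum_univ_two] <;> ring

lemma rot_zero : rot 0 = 1 := by
  ext i j
  fin_cases i <;> fin_cases j <;> simp [rot]

lemma rot_pow (t : ℝ) (m : ℕ) : rot t ^ m = rot (m * t) := by
  induction m with
  | zero => simp [rot_zero]
  | succ m ih => rw [pow_succ, ih, ← rot_add]; congr 1; push_cast; ring

lemma norm_rot_apply (t : ℝ) (v : E2) : ‖toEuc (rot t) v‖ = ‖v‖ := by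
  have h : ‖toEuc (rot t) v‖ ^ 2 = ‖v‖ ^ 2 := by
    rw [norm_sq_E2, norm_sq_E2, toEuc_zero_coord, toEuc_one_coord]
    simp [rot]
    linear_combination (v 0 ^ 2 + v 1 ^ 2) * Real.sin_sq_add_cos_sq t
  exact (sq_eq_sq₀ (norm_nonneg _) (norm_nonneg _)).1 h

lemma norm_rot (t : ℝ) : ‖toEuc (rot t)‖ = 1 := by
  obtain ⟨u, hu, hn⟩ := exists_norm_attained (rot t)
  rw [← hn, norm_rot_apply, hu]

lemma Jr_rot (t : ℝ) (v : E2) : toEuc (rot t) (Jr v) = Jr (toEuc (rot t) v) := by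
  ext i
  fin_cases i
  · simp only [Fin.zero_eta, toEuc_zero_coord, Jr_zero, Jr_one, toEuc_one_coord]
    simp [rot]
    try ring
  · simp only [Fin.mk_one, toEuc_zero_coord, Jr_zero, Jr_one, toEuc_one_coord]
    simp [rot]
    try ring

lemma exists_cos_sin (c s : ℝ) (h : c ^ 2 + s ^ 2 = 1) :
    ∃ t : ℝ, |t| ≤ Real.pi ∧ Real.cos t = c ∧ Real.sin t = s := by
  have hn : ‖(⟨c, s⟩ : ℂ)‖ = 1 := by
    rw [Complex.norm_def, Complex.normSq_mk]
    rw [show c * c + s * s = 1 by nlinarith]; simp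
  refine ⟨Complex.arg ⟨c, s⟩, Complex.abs_arg_le_pi _, ?_, ?_⟩
  · rw [Complex.cos_arg (by rw [← norm_ne_zero_iff, hn]; norm_num), hn]; simp
  · rw [Complex.sin_arg, hn]; simp

lemma exists_rot (u v : E2) (hu : ‖u‖ = 1) (hv : ‖v‖ = 1) :
    ∃ t : ℝ, |t| ≤ Real.pi ∧ toEuc (rot t) u = v := by
  have hu2 := norm_sq_E2 u
  have hv2 := norm_sq_E2 v
  rw [hu] at hu2; rw [hv] at hv2
  obtain ⟨t, ht, hc, hs⟩ := exists_cos_sin (u 0 * v 0 + u 1 * v 1) (u 0 * v 1 - u 1 * v 0) (by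
    linear_combination (-1 : ℝ) * hu2 * (v 0 ^ 2 + v 1 ^ 2) - hv2)
  refine ⟨t, ht, ?_⟩
  ext i
  fin_cases i
  · simp only [Fin.zero_eta, toEuc_zero_coord]
    simp [rot, hc, hs]
    linear_combination (-v 0) * hu2
  · simp only [Fin.mk_one, toEuc_one_coord]
    simp [rot, hc, hs]
    linear_combination (-v 1) * hu2

/-- The swap lemma: a suitable rotation makes expansion and contraction cancel. -/
lemma swap_lemma (g h : SL2) : ∃ t : ℝ, |t| ≤ Real.pi ∧
    ‖toEuc (h * (rot t * g))‖ ≤ ‖toEuc g‖ / ‖toEuc h‖ + ‖toEuc h‖ / ‖toEuc g‖ := by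
  obtain ⟨e, he, hge⟩ := exists_contracted g⁻¹
  obtain ⟨v, hv, hhv⟩ := exists_contracted h
  rw [norm_inv_eq] at hge
  obtain ⟨t, ht, hrot⟩ := exists_rot e v he hv
  have hg := npos g
  have hh := npos h
  refine ⟨t, ht, ContinuousLinearMap.opNorm_le_bound _ (by positivity) fun x => ?_⟩
  rw [toEuc_mul_apply, toEuc_mul_apply]
  set y := toEuc g x with hy
  have hd := decomp e y he
  have hb : |wdg e y| ≤ ‖toEuc g‖⁻¹ * ‖x‖ := by
    rw [← wdg_map g⁻¹, hy, toEuc_inv_apply]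
    refine (abs_wdg_le _ _).trans ?_
    rw [hge]
  have ha : |e 0 * y 0 + e 1 * y 1| ≤ ‖toEuc g‖ * ‖x‖ :=
    (abs_dot_le e y he).trans ((toEuc g).le_opNorm x)
  rw [hd, map_add, map_smul, map_smul, map_add, map_smul, map_smul, hrot, Jr_rot, hrot]
  refine (norm_add_le _ _).trans ?_
  rw [norm_smul, norm_smul, Real.norm_eq_abs, Real.norm_eq_abs, hhv]
  have hJ : ‖toEuc h (Jr v)‖ ≤ ‖toEuc h‖ := by
    simpa [norm_Jr, hv] using (toEuc h).le_opNorm (Jr v)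
  calc _ ≤ (‖toEuc g‖ * ‖x‖) * ‖toEuc h‖⁻¹ + (‖toEuc g‖⁻¹ * ‖x‖) * ‖toEuc h‖ := by gcongr
    _ = _ := by field_simp

/-- Bound via a contracted frame vector. -/
lemma norm_apply_le_frame (g : SL2) (e v : E2) (he : ‖e‖ = 1) :
    ‖toEuc g v‖ ≤ ‖v‖ * ‖toEuc g e‖ + |wdg e v| * ‖toEuc g‖ := by
  have hd := decomp e v he
  have h2 := abs_dot_le e v he
  have hJ : ‖toEuc g (Jr e)‖ ≤ ‖toEuc g‖ := by
    simpa [norm_Jr, he] using (toEuc g).le_opNorm (Jr e)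
  calc ‖toEuc g v‖ = ‖toEuc g ((e 0 * v 0 + e 1 * v 1) • e + (wdg e v) • Jr e)‖ := by rw [← hd]
    _ ≤ |e 0 * v 0 + e 1 * v 1| * ‖toEuc g e‖ + |wdg e v| * ‖toEuc g (Jr e)‖ := by
        rw [map_add, map_smul, map_smul]
        refine (norm_add_le _ _).trans ?_
        rw [norm_smul, norm_smul, Real.norm_eq_abs, Real.norm_eq_abs]
    _ ≤ _ := by gcongr

/-! ### Topology of `SL₂(ℝ)` -/

lemma continuous_coe_SL2 : Continuous (fun g : SL2 => (g : Mat2)) := continuous_subtype_val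

lemma continuous_SL2_iff {X : Type*} [TopologicalSpace X] {f : X → SL2} :
    Continuous f ↔ Continuous (fun x => (f x : Mat2)) :=
  continuous_induced_rng

lemma continuous_toEuclideanCLM :
    Continuous (fun M : Mat2 => Matrix.toEuclideanCLM (𝕜 := ℝ) M) := by
  have : Continuous ((Matrix.toEuclideanCLM (n := Fin 2) (𝕜 := ℝ)).toAlgEquiv.toLinearMap) :=
    LinearMap.continuous_of_finiteDimensional _
  exact this

lemma continuous_toEuc : Continuous toEuc :=
  continuous_toEuclideanCLM.comp continuous_coe_SL2

lemma continuous_rot : Continuous rot := by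
  rw [continuous_SL2_iff]
  refine continuous_matrix fun i j => ?_
  fin_cases i <;> fin_cases j <;> simp [rot] <;> fun_prop

lemma continuous_SL2_mul {X : Type*} [TopologicalSpace X] {f g : X → SL2}
    (hf : Continuous f) (hg : Continuous g) : Continuous (fun x => f x * g x) := by
  rw [continuous_SL2_iff] at *
  simp only [Matrix.SpecialLinearGroup.coe_mul]
  exact hf.matrix_mul hg

lemma opNorm_eq (g : SL2) : opNorm (g : Mat2) = ‖toEuc g‖ := rfl

lemma opNorm_sub (g h : SL2) : opNorm ((g : Mat2) - (h : Mat2)) = ‖toEuc g - toEuc h‖ := by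
  simp [opNorm, toEuc, map_sub]

lemma exists_rot_small (ε : ℝ) (hε : 0 < ε) :
    ∃ r : ℝ, 0 < r ∧ ∀ t : ℝ, |t| ≤ r → ‖toEuc (rot t) - 1‖ < ε := by
  have h : Continuous (fun t => ‖toEuc (rot t) - 1‖) := by
    have := continuous_toEuc.comp continuous_rot
    fun_prop
  have h2 := (h.tendsto 0).eventually (gt_mem_nhds (show ‖toEuc (rot 0) - 1‖ < ε by
    rw [rot_zero, toEuc_one]; simpa using hε))
  obtain ⟨r, hr, hb⟩ := Metric.eventually_nhds_iff.1 h2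
  refine ⟨r / 2, by positivity, fun t ht => hb ?_⟩
  rw [Real.dist_eq, sub_zero]; linarith

/-! ### Uniform exponential growth implies uniform hyperbolicity -/

/-- Cocycle iterates over an abstract map. -/
def coc {X : Type*} (T : X → X) (A : X → SL2) : ℕ → X → SL2
  | 0, _ => 1
  | n + 1, x => coc T A n (T x) * A x

section coc
variable {X : Type*} (T : X → X) (A : X → SL2)

lemma coc_add (m n : ℕ) (x : X) : coc T A (m + n) x = coc T A m (T^[n] x) * coc T A n x := by
  induction n generalizing x with
  | zero => simp [coc]
  | succ n ih =>
    rw [← add_assoc, coc, ih, Function.iterate_succ_apply, coc, mul_assoc]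

lemma coc_succ' (n : ℕ) (x : X) : coc T A (n + 1) x = A (T^[n] x) * coc T A n x := by
  rw [add_comm, coc_add]; simp [coc]

lemma coc_norm_le {K : ℝ} (hK : ∀ x, ‖toEuc (A x)‖ ≤ K) (n : ℕ) (x : X) :
    ‖toEuc (coc T A n x)‖ ≤ K ^ n := by
  have hK0 : 0 ≤ K := (norm_nonneg _).trans (hK x)
  induction n generalizing x with
  | zero => simp [coc, toEuc_one]
  | succ n ih =>
    rw [coc, pow_succ]
    refine (nmul_le _ _).trans ?_
    have := ih (T x); have := hK x
    gcongr

lemma coc_continuous [TopologicalSpace X] (hT : Continuous T) (hA : Continuous A) (n : ℕ) :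
    Continuous (coc T A n) := by
  induction n with
  | zero => exact continuous_const
  | succ n ih => exact continuous_SL2_mul (ih.comp hT) hA

end coc

lemma continuous_wdg : Continuous (fun p : E2 × E2 => wdg p.1 p.2) := by
  unfold wdg
  fun_prop

/-- Telescoping estimate. -/
lemma wdg_chain {K b E : ℝ} (hK : 1 ≤ K) (hb : 1 < b) (hE : 0 < E) (N : ℕ → ℝ) (v : ℕ → E2)
    (hv : ∀ i, ‖v i‖ = 1)
    (hstep : ∀ m, |wdg (v m) (v (m + 1))| ≤ K / (N m * N (m + 1))) (i : ℕ)
    (hgrow : ∀ l, E * b ^ l ≤ N (i + l)) (l : ℕ) :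
    |wdg (v i) (v (i + l))| ≤ K / (1 - b⁻¹) / E ^ 2 := by
  have hb0 : 0 < b := by linarith
  have hr : b⁻¹ < 1 := inv_lt_one_of_one_lt₀ hb
  have hr0 : 0 < b⁻¹ := by positivity
  have key : ∀ l, |wdg (v i) (v (i + l))| ≤ K / E ^ 2 * ∑ j ∈ Finset.range l, (b⁻¹) ^ j := by
    intro l
    induction l with
    | zero => simp [wdg, mul_comm]
    | succ l ih =>
      have h1 := wdg_triangle (v i) (v (i + l)) (v (i + (l + 1))) (hv _)
      rw [hv, hv, mul_one, one_mul] at h1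
      refine h1.trans ?_
      rw [Finset.sum_range_succ, mul_add]
      refine add_le_add ih ((hstep (i + l)).trans ?_)
      have g1 := hgrow l
      have g2 := hgrow (l + 1)
      have hbl : 1 ≤ b ^ (l + 1) := one_le_pow₀ hb.le
      have h3 : E * b ^ l * E ≤ N (i + l) * N (i + l + 1) := by
        have h4 : E ≤ N (i + (l + 1)) := le_trans (le_mul_of_one_le_right hE.le hbl) g2
        rw [← add_assoc] at h4
        have : 0 < E * b ^ l := by positivity
        have h0 : 0 ≤ N (i + l) := this.le.trans g1
        gcongr
      calc K / (N (i + l) * N (i + l + 1)) ≤ K / (E * b ^ l * E) := by gcongr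
        _ = K / E ^ 2 * b⁻¹ ^ l := by rw [inv_pow]; field_simp
  refine (key l).trans ?_
  have hs : ∑ j ∈ Finset.range l, (b⁻¹) ^ j ≤ (1 - b⁻¹)⁻¹ := by
    rw [geom_sum_eq hr.ne, ← neg_div_neg_eq, div_eq_mul_inv, neg_sub, neg_sub]
    have : 0 < (1 - b⁻¹)⁻¹ := inv_pos.2 (by linarith)
    have h5 : 0 ≤ b⁻¹ ^ l := by positivity
    nlinarith
  calc K / E ^ 2 * ∑ j ∈ Finset.range l, (b⁻¹) ^ j ≤ K / E ^ 2 * (1 - b⁻¹)⁻¹ := by gcongr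
    _ = _ := by ring

/-- Good times. -/
lemma exists_good {K b c : ℝ} (hb : 1 < b) (hc : 0 < c) (n0 : ℕ) :
    ∃ I, ∀ N : ℕ → ℝ, (∀ n, N n ≤ K ^ n) → (∀ n, c * (b ^ 2) ^ n ≤ N n) →
      ∃ i, n0 ≤ i ∧ i ≤ I ∧ ∀ l, N i * b ^ l ≤ N (i + l) := by
  have hb0 : 0 < b := by linarith
  obtain ⟨I0, hI0⟩ := pow_unbounded_of_one_lt (K ^ n0 / c) hb
  refine ⟨max I0 n0, fun N hN hN2 => ?_⟩
  obtain ⟨i, hi, hmin⟩ := Finset.exists_min_image (Finset.Icc n0 (max I0 n0))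
    (fun j => N j / b ^ j) ⟨n0, by simp⟩
  rw [Finset.mem_Icc] at hi
  refine ⟨i, hi.1, hi.2, fun l => ?_⟩
  have main : N i / b ^ i ≤ N (i + l) / b ^ (i + l) := by
    by_cases h : i + l ≤ max I0 n0
    · exact hmin _ (Finset.mem_Icc.2 ⟨by omega, h⟩)
    · have h1 := hmin n0 (by simp)
      have h2 : N n0 / b ^ n0 ≤ K ^ n0 := by
        have hNn0 : 0 ≤ N n0 := le_trans (by positivity) (hN2 n0)
        exact (div_le_self hNn0 (one_le_pow₀ hb.le)).trans (hN n0)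
      have h3 : K ^ n0 ≤ c * b ^ (i + l) := by
        rw [div_lt_iff₀ hc] at hI0
        have : b ^ I0 ≤ b ^ (i + l) := pow_le_pow_right₀ hb.le (by omega)
        nlinarith
      have h4 : c * b ^ (i + l) ≤ N (i + l) / b ^ (i + l) := by
        rw [le_div_iff₀ (by positivity)]
        refine le_trans (le_of_eq ?_) (hN2 (i + l))
        ring
      linarith
  rw [div_le_div_iff₀ (by positivity) (by positivity), pow_add] at main
  have : 0 < b ^ i := by positivity
  nlinarith

lemma stable_exists {X : Type*} (T : X → X) (A : X → SL2) {K c b : ℝ} (hK1 : 1 ≤ K)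
    (hK : ∀ x, ‖toEuc (A x)‖ ≤ K) (hc : 0 < c) (hb : 1 < b)
    (hg : ∀ x n, c * (b ^ 2) ^ n ≤ ‖toEuc (coc T A n x)‖) :
    ∃ C : ℝ, 0 < C ∧ ∃ lam : ℝ, 0 < lam ∧ ∀ x, ∃ v : E2, ‖v‖ = 1 ∧
      ∀ n : ℕ, ‖toEuc (coc T A n x) v‖ ≤ C * Real.exp (-lam * n) := by
  have hb0 : 0 < b := by linarith
  have hr : b⁻¹ < 1 := inv_lt_one_of_one_lt₀ hb
  set D := K / (1 - b⁻¹) with hD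
  have hD0 : 0 < D := div_pos (by linarith) (by linarith)
  have hb2 : (1 : ℝ) < b ^ 2 := one_lt_pow₀ hb (by norm_num)
  choose w hw1 hw2 using fun (x : X) (m : ℕ) => exists_contracted (coc T A m x)
  have hstep : ∀ x m, |wdg (w x m) (w x (m + 1))| ≤
      K / (‖toEuc (coc T A m x)‖ * ‖toEuc (coc T A (m + 1) x)‖) := by
    intro x m
    rw [← wdg_map (coc T A m x)]
    refine (abs_wdg_le _ _).trans ?_
    rw [hw2]
    have h1 : toEuc (coc T A m x) (w x (m + 1)) =
        toEuc (A (T^[m] x))⁻¹ (toEuc (coc T A (m + 1) x) (w x (m + 1))) := by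
      rw [coc_succ', toEuc_mul_apply, toEuc_inv_apply]
    have h2 : ‖toEuc (coc T A m x) (w x (m + 1))‖ ≤ K * ‖toEuc (coc T A (m + 1) x)‖⁻¹ := by
      rw [h1]
      refine ((toEuc _).le_opNorm _).trans ?_
      rw [hw2, norm_inv_eq]
      have := hK (T^[m] x)
      gcongr
    have hp := npos (coc T A m x)
    calc _ ≤ ‖toEuc (coc T A m x)‖⁻¹ * (K * ‖toEuc (coc T A (m + 1) x)‖⁻¹) := by gcongr
      _ = _ := by rw [div_eq_mul_inv, mul_inv]; ring
  -- limit vector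
  have hlim : ∀ x, ∃ v : E2, ‖v‖ = 1 ∧ ∀ (i : ℕ) (E : ℝ), 0 < E →
      (∀ l, E * b ^ l ≤ ‖toEuc (coc T A (i + l) x)‖) → |wdg (w x i) v| ≤ D / E ^ 2 := by
    intro x
    obtain ⟨v, hv, φ, hφ, hφl⟩ := (isCompact_sphere (0 : E2) 1).tendsto_subseq
      (x := fun m => w x m) (fun m => by simp [hw1])
    refine ⟨v, by simpa using hv, fun i E hE hgr => ?_⟩
    have ht : Filter.Tendsto (fun k => |wdg (w x i) (w x (φ k))|) Filter.atTop
        (nhds |wdg (w x i) v|) := by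
      have h1 : Continuous (fun u => |wdg (w x i) u|) :=
        (continuous_wdg.comp (Continuous.prodMk continuous_const continuous_id)).abs
      exact (h1.tendsto v).comp hφl
    refine le_of_tendsto ht ?_
    filter_upwards [Filter.eventually_ge_atTop i] with k hk
    obtain ⟨l, hl⟩ := Nat.exists_eq_add_of_le (hk.trans (hφ.id_le k))
    try simp only [id] at hl
    rw [hl]
    exact wdg_chain hK1 hb hE (fun m => ‖toEuc (coc T A m x)‖) (w x) (hw1 x) (hstep x) i hgr l
  choose V hV1 hV2 using hlim
  have hgood : ∀ x i, (∀ l, ‖toEuc (coc T A i x)‖ * b ^ l ≤ ‖toEuc (coc T A (i + l) x)‖) →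
      ‖toEuc (coc T A i x) (V x)‖ ≤ (1 + D) / (c * (b ^ 2) ^ i) := by
    intro x i hi
    have hp := npos (coc T A i x)
    have h1 := hV2 x i _ hp hi
    have h2 := norm_apply_le_frame (coc T A i x) (w x i) (V x) (hw1 x i)
    rw [hV1, hw2, one_mul] at h2
    have h3 : ‖toEuc (coc T A i x) (V x)‖ ≤ (1 + D) / ‖toEuc (coc T A i x)‖ := by
      calc _ ≤ _ := h2
        _ ≤ ‖toEuc (coc T A i x)‖⁻¹ + D / ‖toEuc (coc T A i x)‖ ^ 2 * ‖toEuc (coc T A i x)‖ := by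
          gcongr
        _ = _ := by field_simp
    refine h3.trans ?_
    have := hg x i
    gcongr
  -- uniqueness
  have huniq : ∀ x (u : E2) (M : ℝ), (∀ n0, ∃ i, n0 ≤ i ∧ ‖toEuc (coc T A i x) u‖ ≤ M) →
      wdg (V x) u = 0 := by
    intro x u M hM
    have hM0 : 0 ≤ M := by
      obtain ⟨i, -, hi⟩ := hM 0
      exact (norm_nonneg _).trans hi
    by_contra hne
    have hpos : 0 < |wdg (V x) u| := abs_pos.2 hne
    have hbd : ∀ i, ‖toEuc (coc T A i x) u‖ ≤ M →
        |wdg (V x) u| ≤ (D / c ^ 2 * ‖u‖ + M / c) * b⁻¹ ^ i := by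
      intro i hi
      have h1 := hV2 x i (c * b ^ i) (by positivity) (fun l => by
        refine le_trans ?_ (hg x (i + l))
        rw [mul_assoc, ← pow_add]
        have : b ^ (i + l) ≤ (b ^ 2) ^ (i + l) := by
          rw [← pow_mul]; exact pow_le_pow_right₀ hb.le (by omega)
        gcongr)
      have h2 := wdg_triangle (V x) (w x i) u (hw1 x i)
      rw [hV1, one_mul] at h2
      have h3 : |wdg (w x i) u| ≤ M / (c * b ^ i) := by
        rw [← wdg_map (coc T A i x)]
        refine (abs_wdg_le _ _).trans ?_
        rw [hw2]
        have hp := npos (coc T A i x)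
        have h5 : c * b ^ i ≤ ‖toEuc (coc T A i x)‖ := by
          refine le_trans ?_ (hg x i)
          have : b ^ i ≤ (b ^ 2) ^ i := by
            rw [← pow_mul]; exact pow_le_pow_right₀ hb.le (by omega)
          gcongr
        rw [inv_mul_eq_div]
        gcongr
      have h4 : |wdg (V x) (w x i)| ≤ D / (c * b ^ i) ^ 2 := by
        rw [wdg_comm, abs_neg]; exact h1
      have hbi : 1 ≤ b ^ i := one_le_pow₀ hb.le
      calc |wdg (V x) u| ≤ _ := h2
        _ ≤ D / (c * b ^ i) ^ 2 * ‖u‖ + M / (c * b ^ i) := by gcongr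
        _ ≤ D / (c ^ 2 * b ^ i) * ‖u‖ + M / (c * b ^ i) := by
          have : c ^ 2 * b ^ i ≤ (c * b ^ i) ^ 2 := by
            have : 0 < c ^ 2 := by positivity
            nlinarith
          gcongr
        _ = _ := by rw [inv_pow]; field_simp
    have ht : Filter.Tendsto (fun i : ℕ => (D / c ^ 2 * ‖u‖ + M / c) * b⁻¹ ^ i) Filter.atTop
        (nhds ((D / c ^ 2 * ‖u‖ + M / c) * 0)) :=
      (tendsto_pow_atTop_nhds_zero_of_lt_one (by positivity) hr).const_mul _
    rw [mul_zero] at ht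
    obtain ⟨n0, hn0⟩ := Filter.eventually_atTop.1 (ht.eventually (gt_mem_nhds hpos))
    obtain ⟨i, hi, hi2⟩ := hM n0
    exact absurd (hbd i hi2) (not_le.2 (hn0 i hi))
  -- frequently bounded
  have hgbd : ∀ n0, ∃ I, ∀ x, ∃ i, n0 ≤ i ∧ i ≤ I ∧
      ‖toEuc (coc T A i x) (V x)‖ ≤ (1 + D) / (c * (b ^ 2) ^ i) := by
    intro n0
    obtain ⟨I, hI⟩ := exists_good (K := K) hb hc n0
    refine ⟨I, fun x => ?_⟩
    obtain ⟨i, h1, h2, h3⟩ := hI (fun m => ‖toEuc (coc T A m x)‖)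
      (fun n => coc_norm_le T A hK n x) (hg x)
    exact ⟨i, h1, h2, hgood x i h3⟩
  have hinv : ∀ x, ∃ a : ℝ, toEuc (A x) (V x) = a • V (T x) := by
    intro x
    apply parallel_of_wdg _ _ (hV1 _)
    refine huniq (T x) _ ((1 + D) / c) fun n0 => ?_
    obtain ⟨I, hI⟩ := hgbd (n0 + 1)
    obtain ⟨i, h1, -, h2⟩ := hI x
    obtain ⟨j, rfl⟩ : ∃ j, i = j + 1 := ⟨i - 1, by omega⟩
    refine ⟨j, by omega, ?_⟩
    rw [← toEuc_mul_apply]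
    refine h2.trans ?_
    have : 1 ≤ (b ^ 2) ^ (j + 1) := one_le_pow₀ hb2.le
    have : c ≤ c * (b ^ 2) ^ (j + 1) := le_mul_of_one_le_right hc.le this
    gcongr
  have hinv2 : ∀ n x, ∃ a : ℝ, toEuc (coc T A n x) (V x) = a • V (T^[n] x) := by
    intro n
    induction n with
    | zero => intro x; exact ⟨1, by simp [coc, toEuc_one]⟩
    | succ n ih =>
      intro x
      obtain ⟨a, ha⟩ := hinv x
      obtain ⟨a', ha'⟩ := ih (T x)
      refine ⟨a * a', ?_⟩
      rw [coc, toEuc_mul_apply, ha, map_smul, ha', smul_smul, Function.iterate_succ_apply]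
  -- uniform contraction time
  obtain ⟨n1, hn1⟩ := pow_unbounded_of_one_lt (2 * (1 + D) / c) hb2
  obtain ⟨I0, hI0⟩ := hgbd (n1 + 1)
  set I := I0 + 1 with hIdef
  have hhalf : ∀ x, ∃ i, 1 ≤ i ∧ i ≤ I ∧ ‖toEuc (coc T A i x) (V x)‖ ≤ 1 / 2 := by
    intro x
    obtain ⟨i, h1, h2, h3⟩ := hI0 x
    refine ⟨i, by omega, by omega, h3.trans ?_⟩
    have h4 : (b ^ 2) ^ n1 ≤ (b ^ 2) ^ i := pow_le_pow_right₀ hb2.le (by omega)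
    rw [div_lt_iff₀ hc] at hn1
    rw [div_le_iff₀ (by positivity)]
    nlinarith
  have hIpos : (0 : ℝ) < I := by positivity
  set lam := Real.log 2 / I with hlam
  have hlam0 : 0 < lam := div_pos (Real.log_pos (by norm_num)) hIpos
  have hexp : ∀ i : ℕ, i ≤ I → 1 / 2 ≤ Real.exp (-lam * i) := by
    intro i hi
    have h1 : lam * i ≤ Real.log 2 := by
      rw [hlam, div_mul_eq_mul_div, div_le_iff₀ hIpos]
      have : (i : ℝ) ≤ I := by exact_mod_cast hi
      have := Real.log_pos (show (1 : ℝ) < 2 by norm_num)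
      gcongr
    calc (1 / 2 : ℝ) = Real.exp (-Real.log 2) := by
          rw [Real.exp_neg, Real.exp_log (by norm_num)]; norm_num
      _ ≤ _ := Real.exp_le_exp.2 (by linarith)
  refine ⟨2 * K ^ I, by positivity, lam, hlam0, fun x => ⟨V x, hV1 x, fun n => ?_⟩⟩
  induction n using Nat.strong_induction_on generalizing x with
  | _ n ih =>
    obtain ⟨i, h1, h2, h3⟩ := hhalf x
    by_cases hni : n < i
    · have h4 := coc_norm_le T A hK n x
      have h5 := (toEuc (coc T A n x)).le_opNorm (V x)
      rw [hV1, mul_one] at h5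
      have h6 : K ^ n ≤ K ^ I := pow_le_pow_right₀ hK1 (by omega)
      have h7 := hexp n (by omega)
      have h8 : 0 < K ^ I := by positivity
      nlinarith
    · obtain ⟨m, rfl⟩ : ∃ m, n = m + i := ⟨n - i, by omega⟩
      obtain ⟨a, ha⟩ := hinv2 i x
      have ha2 : |a| ≤ 1 / 2 := by
        rw [ha, norm_smul, hV1, mul_one] at h3; exact h3
      rw [coc_add, toEuc_mul_apply, ha, map_smul, norm_smul, Real.norm_eq_abs]
      have h4 := ih m (by omega) (T^[i] x)
      have h5 := hexp i h2
      calc |a| * ‖toEuc (coc T A m (T^[i] x)) (V (T^[i] x))‖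
          ≤ Real.exp (-lam * i) * (2 * K ^ I * Real.exp (-lam * m)) := by
            gcongr; linarith
        _ = 2 * K ^ I * (Real.exp (-lam * m) * Real.exp (-lam * i)) := by ring
        _ = _ := by rw [← Real.exp_add]; push_cast; ring_nf

/-- The continuous invariant stable section. -/
lemma stable_section {X : Type*} [TopologicalSpace X] [CompactSpace X] [T2Space X]
    (T : X → X) (hT : Continuous T) (A : X → SL2) (hA : Continuous A) {K c b : ℝ} (hK1 : 1 ≤ K)
    (hK : ∀ x, ‖toEuc (A x)‖ ≤ K) (hc : 0 < c) (hb : 1 < b)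
    (hg : ∀ x n, c * (b ^ 2) ^ n ≤ ‖toEuc (coc T A n x)‖) :
    ∃ es : X → Pone, Continuous es ∧ (∀ x, pact (A x) (es x) = es (T x)) ∧
    ∃ C : ℝ, 0 < C ∧ ∃ lam : ℝ, 0 < lam ∧ ∀ x (n : ℕ), ∀ v ∈ (es x).submodule,
      ‖toEuc (coc T A n x) v‖ ≤ C * Real.exp (-lam * n) * ‖v‖ := by
  obtain ⟨C, hC, lam, hlam, hex⟩ := stable_exists T A hK1 hK hc hb hg
  choose V hV1 hV2 using hex
  have hb2 : (1 : ℝ) < b ^ 2 := one_lt_pow₀ hb (by norm_num)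
  have hV0 : ∀ x, V x ≠ 0 := fun x h => by have := hV1 x; rw [h] at this; simp at this
  have hexp1 : ∀ n : ℕ, Real.exp (-lam * n) ≤ 1 := fun n => by
    rw [Real.exp_le_one_iff]
    have : 0 ≤ lam * n := by positivity
    linarith
  -- uniqueness among bounded vectors
  have huniq : ∀ x (u : E2) (M : ℝ), (∀ n, ‖toEuc (coc T A n x) u‖ ≤ M) →
      ∃ a : ℝ, u = a • V x := by
    intro x u M hM
    apply parallel_of_wdg _ _ (hV1 x)
    by_contra hne
    have hpos : 0 < |wdg (V x) u| := abs_pos.2 hne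
    have hM0 : 0 ≤ M := (norm_nonneg _).trans (hM 0)
    -- the norm of the iterates would be bounded
    have hbound : ∀ n, ‖toEuc (coc T A n x)‖ * |wdg (V x) u| ≤ C * ‖u‖ + M := by
      intro n
      obtain ⟨z, hz, hzn⟩ := exists_norm_attained (coc T A n x)
      have hid : wdg (V x) u • z = (wdg z u) • V x + (wdg (V x) z) • u := by
        ext i
        fin_cases i <;>
          simp only [Fin.zero_eta, Fin.mk_one, PiLp.add_apply, PiLp.smul_apply, smul_eq_mul, wdg] <;> ring
      rw [← hzn, mul_comm, ← Real.norm_eq_abs, ← norm_smul, ← map_smul, hid, map_add, map_smul,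
        map_smul]
      refine (norm_add_le _ _).trans ?_
      rw [norm_smul, norm_smul, Real.norm_eq_abs, Real.norm_eq_abs]
      have h1 := abs_wdg_le z u
      have h2 := abs_wdg_le (V x) z
      rw [hz] at h1 h2
      rw [hV1] at h2
      have h3 : ‖toEuc (coc T A n x) (V x)‖ ≤ C := (hV2 x n).trans (by
        have := hexp1 n; nlinarith)
      have h4 := hM n
      calc _ ≤ (1 * ‖u‖) * C + (1 * 1) * M := by gcongr
        _ = _ := by ring
    obtain ⟨n, hn⟩ := pow_unbounded_of_one_lt ((C * ‖u‖ + M) / |wdg (V x) u| / c) hb2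
    rw [div_lt_iff₀ hc, div_lt_iff₀ hpos] at hn
    have h1 := hbound n
    have h2 := hg x n
    nlinarith
  let es : X → Pone := fun x => Projectivization.mk ℝ (V x) (hV0 x)
  refine ⟨es, ?_, ?_, C, hC, lam, hlam, ?_⟩
  · -- continuity
    let S := Metric.sphere (0 : E2) 1
    have : CompactSpace S := isCompact_iff_compactSpace.1 (isCompact_sphere (0 : E2) 1)
    have hS0 : ∀ s : S, (s : E2) ≠ 0 := fun s h => by
      have := s.2
      rw [h] at this; simp [S] at this
    have hmk : Continuous (fun s : S => (Projectivization.mk ℝ (s : E2) (hS0 s) : Pone)) := by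
      have h1 : Continuous (fun s : S => (⟨(s : E2), hS0 s⟩ : { v : E2 // v ≠ 0 })) := by
        fun_prop
      exact (continuous_quot_mk (r := (projectivizationSetoid ℝ E2))).comp h1
    refine continuous_iff_isClosed.2 fun F hF => ?_
    have himg : es ⁻¹' F = Prod.fst '' {p : X × S |
        (Projectivization.mk ℝ (p.2 : E2) (hS0 p.2) : Pone) ∈ F ∧
        ∀ n : ℕ, ‖toEuc (coc T A n p.1) p.2‖ ≤ C * Real.exp (-lam * n)} := by
      ext x
      constructor
      · intro hx
        exact ⟨(x, ⟨V x, by simp [S, hV1]⟩), ⟨hx, hV2 x⟩, rfl⟩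
      · rintro ⟨⟨x', s⟩, ⟨h1, h2⟩, rfl⟩
        obtain ⟨a, ha⟩ := huniq x' s C (fun n => (h2 n).trans (by
          have := hexp1 n; nlinarith))
        have : es x' = Projectivization.mk ℝ (s : E2) (hS0 s) := by
          rw [eq_comm, Projectivization.mk_eq_mk_iff']
          exact ⟨a, ha.symm⟩
        show es x' ∈ F
        rw [this]; exact h1
    rw [himg]
    have hcl : IsClosed {p : X × S |
        (Projectivization.mk ℝ (p.2 : E2) (hS0 p.2) : Pone) ∈ F ∧
        ∀ n : ℕ, ‖toEuc (coc T A n p.1) p.2‖ ≤ C * Real.exp (-lam * n)} := by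
      have h1 : IsClosed {p : X × S | (Projectivization.mk ℝ (p.2 : E2) (hS0 p.2) : Pone) ∈ F} :=
        hF.preimage (hmk.comp continuous_snd)
      have h2 : ∀ n : ℕ, IsClosed {p : X × S |
          ‖toEuc (coc T A n p.1) p.2‖ ≤ C * Real.exp (-lam * n)} := by
        intro n
        have h3 : Continuous (fun p : X × S => toEuc (coc T A n p.1)) :=
          continuous_toEuc.comp ((coc_continuous T A hT hA n).comp continuous_fst)
        have h4 : Continuous (fun p : X × S => toEuc (coc T A n p.1) (p.2 : E2)) :=
          h3.clm_apply (continuous_subtype_val.comp continuous_snd)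
        exact isClosed_le h4.norm continuous_const
      have h5 := h1.inter (isClosed_iInter h2)
      convert h5 using 1
      ext p; simp
    exact (hcl.isCompact.image continuous_fst).isClosed
  · intro x
    have h1 : pact (A x) (es x) = Projectivization.mk ℝ (toEuc (A x) (V x))
        (fun h => hV0 x (toEuc_injective (A x) (by rw [h, map_zero]))) := by
      simp only [es, pact]
      rw [Projectivization.map_mk]; rfl
    rw [h1]
    simp only [es]
    rw [Projectivization.mk_eq_mk_iff']
    obtain ⟨a, ha⟩ := huniq (T x) (toEuc (A x) (V x)) C (fun n => by
      have h2 := hV2 x (n + 1)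
      rw [coc, toEuc_mul_apply] at h2
      refine h2.trans ?_
      have := hexp1 (n + 1); nlinarith)
    exact ⟨a, ha.symm⟩
  · intro x n v hv
    simp only [es, Projectivization.submodule_mk, Submodule.mem_span_singleton] at hv
    obtain ⟨a, rfl⟩ := hv
    rw [map_smul, norm_smul, norm_smul, hV1, mul_one, mul_comm]
    have := hV2 x n
    gcongr

/-! ### Shifts -/

/-- Integer powers of the shift. -/
def sh {κ : ℕ} (j : ℤ) (x : Sig κ) : Sig κ := fun n => x (n + j)

section sh
variable {κ : ℕ}

lemma sh_apply (j n : ℤ) (x : Sig κ) : sh j x n = x (n + j) := rfl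
lemma shift_eq_sh (x : Sig κ) : shift x = sh 1 x := rfl
lemma sh_sh (i j : ℤ) (x : Sig κ) : sh i (sh j x) = sh (i + j) x := by
  funext n; simp only [sh_apply, add_assoc]
lemma sh_zero (x : Sig κ) : sh 0 x = x := by funext n; simp [sh_apply]
lemma shift_iter (n : ℕ) (x : Sig κ) : shift^[n] x = sh n x := by
  induction n with
  | zero => simp [sh_zero]
  | succ n ih =>
    rw [Function.iterate_succ_apply', ih, shift_eq_sh, sh_sh]; congr 1; push_cast; ring
lemma continuous_sh (j : ℤ) : Continuous (sh j : Sig κ → Sig κ) :=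
  continuous_pi fun n => continuous_apply (n + j)
lemma continuous_shift : Continuous (shift : Sig κ → Sig κ) := continuous_sh 1

lemma cocycleN_eq (A : Sig κ → SL2) (n : ℕ) (x : Sig κ) : cocycleN A n x = coc shift A n x := by
  induction n generalizing x with
  | zero => rfl
  | succ n ih => rw [cocycleN, coc, ih]

lemma exists_bound (A : Sig κ → SL2) (hA : Continuous A) :
    ∃ K : ℝ, 1 ≤ K ∧ ∀ x, ‖toEuc (A x)‖ ≤ K := by
  have h : Continuous (fun x => toEuc (A x)) := continuous_toEuc.comp hA
  obtain ⟨K, hK⟩ := (isCompact_range h).isBounded.exists_norm_le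
  exact ⟨max 1 K, le_max_left _ _, fun x => (hK _ ⟨x, rfl⟩).trans (le_max_right _ _)⟩

lemma uh_of_growth (A : Sig κ → SL2) (hA : Continuous A) {c b : ℝ} (hc : 0 < c) (hb : 1 < b)
    (hg : ∀ x n, c * (b ^ 2) ^ n ≤ ‖toEuc (coc shift A n x)‖) : UniformlyHyperbolic A := by
  obtain ⟨K, hK1, hK⟩ := exists_bound A hA
  obtain ⟨es, hes, hesi, C, hC, lam, hlam, hb1⟩ :=
    stable_section shift continuous_shift A hA hK1 hK hc hb hg
  let A' : Sig κ → SL2 := fun x => (A (sh (-1) x))⁻¹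
  have hA' : Continuous A' := by
    rw [continuous_SL2_iff]
    simp only [A', Matrix.SpecialLinearGroup.coe_inv]
    exact (continuous_coe_SL2.comp (hA.comp (continuous_sh (-1)))).matrix_adjugate
  have hrev : ∀ n x, coc (sh (-1)) A' n (shift^[n] x) = (coc shift A n x)⁻¹ := by
    intro n x
    induction n with
    | zero => simp [coc]
    | succ n ih =>
      have h1 : sh (-1) (shift^[n + 1] x) = shift^[n] x := by
        rw [shift_iter, shift_iter, sh_sh]; congr 1; push_cast; ring
      rw [coc, h1, ih, coc_succ', mul_inv_rev]
      simp only [A', h1]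
  have hrev2 : ∀ n x, coc (sh (-1)) A' n x = (coc shift A n (sh (-n) x))⁻¹ := by
    intro n x
    rw [← hrev, shift_iter, sh_sh]; simp [sh_zero]
  obtain ⟨eu, heu, heui, C', hC', lam', hlam', hb2⟩ :=
    stable_section (sh (-1)) (continuous_sh (-1)) A' hA' hK1
      (fun x => by rw [norm_inv_eq]; exact hK _) hc hb
      (fun x n => by rw [hrev2, norm_inv_eq]; exact hg _ _)
  refine ⟨es, eu, hes, heu, hesi, ?_, max C C', lt_max_of_lt_left hC, min lam lam',
    lt_min hlam hlam', ?_⟩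
  · intro x
    have h1 := heui (shift x)
    have h2 : sh (-1) (shift x) = x := by rw [shift_eq_sh, sh_sh]; simp [sh_zero]
    simp only [A', h2] at h1
    rw [← h1]
    induction eu (shift x) using Projectivization.ind with
    | h v hv =>
      simp only [pact, Projectivization.map_mk]
      congr 1
      exact toEuc_apply_inv _ _
  · intro x n hn
    have hmono : ∀ l, min lam lam' ≤ l → Real.exp (-l * n) ≤ Real.exp (-(min lam lam') * n) := by
      intro l hl
      apply Real.exp_le_exp.2
      have : (0 : ℝ) ≤ n := Nat.cast_nonneg n
      nlinarith
    refine ⟨fun v hv => ?_, fun w hw => ?_⟩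
    · rw [cocycleN_eq]
      refine (hb1 x n v hv).trans ?_
      have := hmono lam (min_le_left _ _)
      have := le_max_left C C'
      gcongr
    · rw [cocycleN_eq, ← hrev]
      refine (hb2 _ n w hw).trans ?_
      have := hmono lam' (min_le_right _ _)
      have := le_max_right C C'
      gcongr

lemma growth_fails (A : Sig κ → SL2) (hA : Continuous A) (hN : ¬ UniformlyHyperbolic A)
    {c a : ℝ} (hc : 0 < c) (ha : 1 < a) :
    ∃ x n, ‖toEuc (coc shift A n x)‖ < c * a ^ n := by
  by_contra! h
  refine hN (uh_of_growth A hA hc (b := Real.sqrt a) (Real.lt_sqrt_of_sq_lt (by simpa)) ?_)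
  intro x n
  rw [Real.sq_sqrt (by linarith)]
  exact h x n

end sh

/-! ### The trace polynomial -/

/-- ordered products -/
def cprod (C : ℕ → SL2) : ℕ → SL2
  | 0 => 1
  | n + 1 => C n * cprod C n

def alf (g : SL2) : ℂ := ⟨((g : Mat2) 0 0 + (g : Mat2) 1 1) / 2, ((g : Mat2) 1 0 - (g : Mat2) 0 1) / 2⟩
def bet (g : SL2) : ℂ := ⟨((g : Mat2) 0 0 - (g : Mat2) 1 1) / 2, ((g : Mat2) 1 0 + (g : Mat2) 0 1) / 2⟩

lemma alf_bet (g : SL2) : Complex.normSq (alf g) - Complex.normSq (bet g) = 1 := by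
  have := SL2_det g
  simp only [alf, bet, Complex.normSq_mk]
  linarith

lemma SL2_mul_coord (g h : SL2) (i j : Fin 2) : ((g * h : SL2) : Mat2) i j =
    (g : Mat2) i 0 * (h : Mat2) 0 j + (g : Mat2) i 1 * (h : Mat2) 1 j := by
  rw [Matrix.SpecialLinearGroup.coe_mul, Matrix.mul_apply, Fin.sum_univ_two]

lemma alf_mul (g h : SL2) : alf (g * h) = alf g * alf h + bet g * star (bet h) := by
  apply Complex.ext <;> simp [alf, bet, SL2_mul_coord] <;> ring

lemma bet_mul (g h : SL2) : bet (g * h) = alf g * bet h + bet g * star (alf h) := by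
  apply Complex.ext <;> simp [alf, bet, SL2_mul_coord] <;> ring

lemma alf_rot (t : ℝ) : alf (rot t) = Complex.exp (t * Complex.I) := by
  rw [Complex.exp_mul_I]
  apply Complex.ext <;> simp [alf, rot, ← Complex.ofReal_cos, ← Complex.ofReal_sin]

lemma bet_rot (t : ℝ) : bet (rot t) = 0 := by
  apply Complex.ext <;> simp [bet, rot]

lemma alf_one : alf 1 = 1 := by rw [← rot_zero, alf_rot]; simp
lemma bet_one : bet 1 = 0 := by rw [← rot_zero, bet_rot]

lemma alf_ne (g : SL2) : alf g ≠ 0 := by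
  intro h
  have := alf_bet g
  rw [h] at this
  have := Complex.normSq_nonneg (bet g)
  simp at *
  linarith

open Polynomial in
/-- column recursion -/
def pcol (C : ℕ → SL2) (v : ℂ[X] × ℂ[X]) : ℕ → ℂ[X] × ℂ[X]
  | 0 => v
  | n + 1 => (Polynomial.C (alf (C n)) * X * (pcol C v n).1 + Polynomial.C (bet (C n)) * (pcol C v n).2,
      Polynomial.C (star (bet (C n))) * X * (pcol C v n).1 + Polynomial.C (star (alf (C n))) * (pcol C v n).2)

open Polynomial in
def tpol (C : ℕ → SL2) (n : ℕ) : ℂ[X] := (pcol C (1, 0) n).1 + (pcol C (0, 1) n).2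

/-- numeric column recursion -/
def ncol (C : ℕ → SL2) (w : ℂ) (v : ℂ × ℂ) : ℕ → ℂ × ℂ
  | 0 => v
  | n + 1 => (alf (C n) * w * (ncol C w v n).1 + bet (C n) * (ncol C w v n).2,
      star (bet (C n)) * w * (ncol C w v n).1 + star (alf (C n)) * (ncol C w v n).2)

lemma ncol_lin (C : ℕ → SL2) (w : ℂ) (x y : ℂ) (n : ℕ) :
    ncol C w (x, y) n = ((pcol C (1, 0) n).1.eval w * x + (pcol C (0, 1) n).1.eval w * y,
      (pcol C (1, 0) n).2.eval w * x + (pcol C (0, 1) n).2.eval w * y) := by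
  induction n with
  | zero => simp [ncol, pcol]
  | succ n ih =>
    simp only [ncol, pcol, ih, Polynomial.eval_add, Polynomial.eval_mul, Polynomial.eval_C,
      Polynomial.eval_X]
    ext <;> simp <;> ring

lemma cone_step (g : SL2) (w x y : ℂ) :
    Complex.normSq (alf g * w * x + bet g * y) - Complex.normSq (star (bet g) * w * x + star (alf g) * y)
      = Complex.normSq (w * x) - Complex.normSq y := by
  have h := alf_bet g
  set a := alf g
  set b := bet g
  have : Complex.normSq (a * w * x + b * y) - Complex.normSq (star b * w * x + star a * y)
      = (Complex.normSq a - Complex.normSq b) * (Complex.normSq (w * x) - Complex.normSq y) := by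
    simp only [Complex.normSq_apply, Complex.star_def, Complex.add_re, Complex.mul_re, Complex.conj_re, Complex.conj_im,
      Complex.mul_im, Complex.add_im]
    ring
  rw [this, h, one_mul]

lemma ncol_cone_lt (C : ℕ → SL2) (w : ℂ) (hw : Complex.normSq w < 1) (x y : ℂ)
    (h : Complex.normSq x ≤ Complex.normSq y) (hy : 0 < Complex.normSq y) (n : ℕ) :
    (Complex.normSq (ncol C w (x, y) n).1 ≤ Complex.normSq (ncol C w (x, y) n).2 ∧
      0 < Complex.normSq (ncol C w (x, y) n).2) ∧
    (1 ≤ n → Complex.normSq (ncol C w (x, y) n).1 < Complex.normSq (ncol C w (x, y) n).2) := by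
  induction n with
  | zero => exact ⟨⟨h, hy⟩, fun h => absurd h (by norm_num)⟩
  | succ n ih =>
    obtain ⟨⟨h1, h2⟩, -⟩ := ih
    have := cone_step (C n) w (ncol C w (x, y) n).1 (ncol C w (x, y) n).2
    rw [Complex.normSq_mul w] at this
    have h0 := Complex.normSq_nonneg (ncol C w (x, y) n).1
    have hlt : Complex.normSq (ncol C w (x, y) (n+1)).1 < Complex.normSq (ncol C w (x, y) (n+1)).2 := by
      simp only [ncol]
      nlinarith [Complex.normSq_nonneg w]
    exact ⟨⟨hlt.le, lt_of_le_of_lt (Complex.normSq_nonneg _) hlt⟩, fun _ => hlt⟩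

lemma ncol_cone_gt (C : ℕ → SL2) (w : ℂ) (hw : 1 < Complex.normSq w) (x y : ℂ)
    (h : Complex.normSq y ≤ Complex.normSq x) (hy : 0 < Complex.normSq x) (n : ℕ) :
    (Complex.normSq (ncol C w (x, y) n).2 ≤ Complex.normSq (ncol C w (x, y) n).1 ∧
      0 < Complex.normSq (ncol C w (x, y) n).1) ∧
    (1 ≤ n → Complex.normSq (ncol C w (x, y) n).2 < Complex.normSq (ncol C w (x, y) n).1) := by
  induction n with
  | zero => exact ⟨⟨h, hy⟩, fun h => absurd h (by norm_num)⟩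
  | succ n ih =>
    obtain ⟨⟨h1, h2⟩, -⟩ := ih
    have := cone_step (C n) w (ncol C w (x, y) n).1 (ncol C w (x, y) n).2
    rw [Complex.normSq_mul w] at this
    have hlt : Complex.normSq (ncol C w (x, y) (n+1)).2 < Complex.normSq (ncol C w (x, y) (n+1)).1 := by
      simp only [ncol]
      nlinarith [Complex.normSq_nonneg w]
    exact ⟨⟨hlt.le, lt_of_le_of_lt (Complex.normSq_nonneg _) hlt⟩, fun _ => hlt⟩

lemma ncol_sq (C : ℕ → SL2) (w : ℂ) (n : ℕ) (h : (tpol C n).eval w = 0) :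
    ∃ d : ℂ, ncol C w (ncol C w (1, 1) n) n = (d, d) := by
  have h1 := ncol_lin C w 1 1 n
  have h2 := ncol_lin C w (ncol C w (1, 1) n).1 (ncol C w (1, 1) n).2 n
  rw [Prod.mk.eta] at h2
  simp only [tpol, Polynomial.eval_add] at h
  refine ⟨-((pcol C (1, 0) n).1.eval w * (pcol C (0, 1) n).2.eval w -
    (pcol C (0, 1) n).1.eval w * (pcol C (1, 0) n).2.eval w), ?_⟩
  rw [h2, h1]
  have h3 : (pcol C (1, 0) n).1.eval w = - (pcol C (0, 1) n).2.eval w := by linear_combination h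
  ext <;> simp <;> rw [h3] <;> ring

lemma root_unimod (C : ℕ → SL2) (w : ℂ) (n : ℕ) (hn : 1 ≤ n) (h : (tpol C n).eval w = 0) :
    Complex.normSq w = 1 := by
  obtain ⟨d, hd⟩ := ncol_sq C w n h
  rcases lt_trichotomy (Complex.normSq w) 1 with hw | hw | hw
  · obtain ⟨⟨a1, a2⟩, -⟩ := ncol_cone_lt C w hw 1 1 le_rfl (by simp) n
    obtain ⟨-, a3⟩ := ncol_cone_lt C w hw _ _ a1 a2 n
    have := a3 hn
    rw [Prod.mk.eta, hd] at this
    simp at this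
  · exact hw
  · obtain ⟨⟨a1, a2⟩, -⟩ := ncol_cone_gt C w hw 1 1 le_rfl (by simp) n
    obtain ⟨-, a3⟩ := ncol_cone_gt C w hw _ _ a1 a2 n
    have := a3 hn
    rw [Prod.mk.eta, hd] at this
    simp at this

lemma pcol_coeff (C : ℕ → SL2) (n : ℕ) :
    (∀ k, n + 1 < k → (pcol C (1, 0) (n+1)).1.coeff k = 0) ∧
    (pcol C (1, 0) (n+1)).1.coeff (n+1) = ∏ j ∈ Finset.range (n+1), alf (C j) ∧
    (∀ k, n + 1 < k → (pcol C (1, 0) (n+1)).2.coeff k = 0) ∧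
    (∀ k, n + 1 ≤ k → (pcol C (0, 1) (n+1)).1.coeff k = 0) ∧
    (∀ k, n + 1 ≤ k → (pcol C (0, 1) (n+1)).2.coeff k = 0) := by
  induction n with
  | zero =>
    simp only [pcol]
    refine ⟨?_, ?_, ?_, ?_, ?_⟩
    · intro k hk
      have : k ≠ 1 := by omega
      simp [mul_assoc, Polynomial.coeff_C_mul, Polynomial.coeff_X, this.symm]
    · simp [Polynomial.coeff_C_mul]
    · intro k hk
      have : k ≠ 1 := by omega
      simp [mul_assoc, Polynomial.coeff_C_mul, Polynomial.coeff_X, this.symm]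
    · intro k hk
      have : k ≠ 0 := by omega
      simp [Polynomial.coeff_C, this]
    · intro k hk
      have : k ≠ 0 := by omega
      simp only [mul_zero, zero_add, mul_one]
      rw [Polynomial.coeff_C]; simp [this]
  | succ n ih =>
    obtain ⟨h1, h2, h3, h4, h5⟩ := ih
    have key : ∀ (a b : ℂ) (P Q : Polynomial ℂ) (k : ℕ),
        (Polynomial.C a * Polynomial.X * P + Polynomial.C b * Q).coeff (k + 1)
          = a * P.coeff k + b * Q.coeff (k + 1) := by
      intro a b P Q k
      rw [mul_assoc, Polynomial.coeff_add, Polynomial.coeff_C_mul, Polynomial.coeff_C_mul,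
        Polynomial.coeff_X_mul]
    refine ⟨?_, ?_, ?_, ?_, ?_⟩
    · rintro (_ | k) hk
      · omega
      · rw [pcol, key, h1 k (by omega), h3 (k+1) (by omega)]; simp
    · rw [pcol, key, h2, h3 _ (by omega), Finset.prod_range_succ _ (n+1)]; ring
    · rintro (_ | k) hk
      · omega
      · rw [pcol, key, h1 k (by omega), h3 (k+1) (by omega)]; simp
    · rintro (_ | k) hk
      · omega
      · rw [pcol, key, h4 k (by omega), h5 (k+1) (by omega)]; simp
    · rintro (_ | k) hk
      · omega
      · rw [pcol, key, h4 k (by omega), h5 (k+1) (by omega)]; simp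

lemma tpol_natDegree (C : ℕ → SL2) (n : ℕ) (hn : 1 ≤ n) : (tpol C n).natDegree = n := by
  obtain ⟨n, rfl⟩ := Nat.exists_eq_add_of_le' hn
  obtain ⟨h1, h2, h3, h4, h5⟩ := pcol_coeff C n
  apply Polynomial.natDegree_eq_of_le_of_coeff_ne_zero
  · rw [Polynomial.natDegree_le_iff_coeff_eq_zero]
    intro k hk
    rw [tpol, Polynomial.coeff_add, h1 k hk, h5 k hk.le, add_zero]
  · rw [tpol, Polynomial.coeff_add, h2, h5 _ le_rfl, add_zero]
    exact Finset.prod_ne_zero_iff.2 fun j _ => alf_ne _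

/-- real trace -/
def tr2 (g : SL2) : ℝ := (g : Mat2) 0 0 + (g : Mat2) 1 1

lemma tr_alf (g : SL2) : ((tr2 g : ℝ) : ℂ) = alf g + star (alf g) := by
  apply Complex.ext <;> simp [alf, tr2]

lemma pcol_exp (C : ℕ → SL2) (t : ℝ) (n : ℕ) :
    let w := Complex.exp (2 * t * Complex.I)
    let e := Complex.exp (n * (t * Complex.I))
    let P := cprod (fun j => C j * rot t) n
    (pcol C (1, 0) n).1.eval w = e * alf P ∧ (pcol C (0, 1) n).1.eval w = e * bet P ∧
    (pcol C (1, 0) n).2.eval w = e * star (bet P) ∧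
    (pcol C (0, 1) n).2.eval w = e * star (alf P) := by
  induction n with
  | zero => simp [pcol, cprod, alf_one, bet_one]
  | succ n ih =>
    intro w e P
    obtain ⟨h1, h2, h3, h4⟩ := ih
    set u := Complex.exp (t * Complex.I) with hu
    have hw : w = u * u := by rw [hu, ← Complex.exp_add]; simp only [w]; congr 1; ring
    have he : e = u * Complex.exp (n * (t * Complex.I)) := by
      rw [hu, ← Complex.exp_add]; simp only [e]; congr 1; push_cast; ring
    have hu1 : u * star u = 1 := by
      rw [hu, Complex.star_def, ← Complex.exp_conj, ← Complex.exp_add]; simp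
    set e0 := Complex.exp (n * (t * Complex.I)) with he0
    set P0 := cprod (fun j => C j * rot t) n with hP0
    have hP : P = (C n * rot t) * P0 := rfl
    have ha : alf (C n * rot t) = alf (C n) * u := by
      rw [alf_mul, alf_rot, bet_rot]; simp [hu]
    have hb : bet (C n * rot t) = bet (C n) * star u := by
      rw [bet_mul, alf_rot, bet_rot]; simp [hu]
    simp only [pcol, Polynomial.eval_add, Polynomial.eval_mul, Polynomial.eval_C, Polynomial.eval_X]
    change Polynomial.eval w _ = _ at h1 h2 h3 h4
    rw [h1, h2, h3, h4, hP, alf_mul _ P0, bet_mul _ P0, ha, hb, hw, he]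
    simp only [star_add, star_mul', star_star]
    refine ⟨?_, ?_, ?_, ?_⟩
    · linear_combination (-(bet (C n) * e0 * star (bet P0))) * hu1
    · linear_combination (-(bet (C n) * e0 * star (alf P0))) * hu1
    · linear_combination (-(star (alf (C n)) * e0 * star (bet P0))) * hu1
    · linear_combination (-(star (alf (C n)) * e0 * star (alf P0))) * hu1

/-- the trace function -/
def trf (C : ℕ → SL2) (q : ℕ) (t : ℝ) : ℝ := tr2 (cprod (fun j => C j * rot t) q)

lemma trf_eq (C : ℕ → SL2) (q : ℕ) (t : ℝ) :
    (tpol C q).eval (Complex.exp (2 * t * Complex.I)) = Complex.exp (q * (t * Complex.I)) * (trf C q t : ℝ) := by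
  obtain ⟨h1, h2, h3, h4⟩ := pcol_exp C t q
  rw [tpol, Polynomial.eval_add, h1, h4, trf, tr_alf]; ring

lemma trf_abs (C : ℕ → SL2) (q : ℕ) (t : ℝ) :
    ‖(tpol C q).eval (Complex.exp (2 * t * Complex.I))‖ = |trf C q t| := by
  rw [trf_eq, norm_mul]
  have : Complex.exp (q * (t * Complex.I)) = Complex.exp ((q * t : ℝ) * Complex.I) := by
    congr 1; push_cast; ring
  rw [this, Complex.norm_exp_ofReal_mul_I, one_mul, Complex.norm_real, Real.norm_eq_abs]

lemma norm_sq_C (z : ℂ) : ‖z‖ ^ 2 = z.re ^ 2 + z.im ^ 2 := by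
  rw [← Complex.normSq_eq_norm_sq, Complex.normSq_apply]; ring

lemma exp_two_re (s : ℝ) : (Complex.exp (2 * s * Complex.I)).re = Real.cos (2 * s) := by
  have : (2 * s * Complex.I : ℂ) = ((2 * s : ℝ) : ℂ) * Complex.I := by push_cast; ring
  rw [this, Complex.exp_ofReal_mul_I_re]

lemma exp_two_im (s : ℝ) : (Complex.exp (2 * s * Complex.I)).im = Real.sin (2 * s) := by
  have : (2 * s * Complex.I : ℂ) = ((2 * s : ℝ) : ℂ) * Complex.I := by push_cast; ring
  rw [this, Complex.exp_ofReal_mul_I_im]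

lemma root_factor_aux (A B D c s u v : ℝ) (hA0 : 0 ≤ A) (hB0 : 0 ≤ B)
    (hcs : s ^ 2 + c ^ 2 = 1) (hu : u ^ 2 + v ^ 2 = 1) (h : u < c)
    (hA : A ^ 2 = (c - u) ^ 2 + (s - v) ^ 2) (hB : B ^ 2 = (c - u) ^ 2 + (-s - v) ^ 2)
    (hD : D ^ 2 = (1 - u) ^ 2 + v ^ 2) : A * B ≤ (c + 1) / 2 * D ^ 2 := by
  have hA' : A ^ 2 = 2 - 2 * c * u - 2 * s * v := by linear_combination hA + hcs + hu
  have hB' : B ^ 2 = 2 - 2 * c * u + 2 * s * v := by linear_combination hB + hcs + hu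
  have hD' : D ^ 2 = 2 - 2 * u := by linear_combination hD + hu
  have hprod : (A * B) ^ 2 = (2 * (c - u)) ^ 2 := by
    rw [mul_pow, hA', hB']
    linear_combination (-4 * v ^ 2) * hcs + (-4 + 4 * c ^ 2) * hu
  have hprod' := (sq_eq_sq₀ (by positivity) (by linarith)).1 hprod
  rw [hprod', hD']
  have hc1 : c ≤ 1 := by
    have : c ^ 2 ≤ 1 := by linarith [sq_nonneg s]
    exact (abs_le.1 ((sq_le_one_iff_abs_le_one c).1 this)).2
  have hu1 : -1 ≤ u := by
    have : u ^ 2 ≤ 1 := by linarith [sq_nonneg v]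
    exact (abs_le.1 ((sq_le_one_iff_abs_le_one u).1 this)).1
  linarith [mul_nonneg (sub_nonneg.2 hc1) (sub_nonneg.2 hu1)]

lemma root_factor (w : ℂ) (hw : Complex.normSq w = 1) (ε : ℝ) (h : w.re < Real.cos (2 * ε)) :
    ‖Complex.exp (2 * ε * Complex.I) - w‖ * ‖Complex.exp (2 * (-ε : ℝ) * Complex.I) - w‖
      ≤ (Real.cos ε) ^ 2 * ‖Complex.exp (2 * (0:ℝ) * Complex.I) - w‖ ^ 2 := by
  have hu : w.re ^ 2 + w.im ^ 2 = 1 := by rw [Complex.normSq_apply] at hw; linarith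
  have hc : Real.cos ε ^ 2 = (Real.cos (2 * ε) + 1) / 2 := by
    rw [Real.cos_two_mul ε]; ring
  rw [hc]
  apply root_factor_aux _ _ _ (Real.cos (2 * ε)) (Real.sin (2 * ε)) w.re w.im (norm_nonneg _)
    (norm_nonneg _) (Real.sin_sq_add_cos_sq (2 * ε)) hu h
  · rw [norm_sq_C, Complex.sub_re, Complex.sub_im, exp_two_re, exp_two_im]
  · rw [norm_sq_C, Complex.sub_re, Complex.sub_im, exp_two_re, exp_two_im, mul_neg, Real.cos_neg,
      Real.sin_neg]
  · rw [norm_sq_C, Complex.sub_re, Complex.sub_im, exp_two_re, exp_two_im]; simp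

lemma root_angle (w : ℂ) (hw : Complex.normSq w = 1) (ε : ℝ) (h0 : 0 < ε) (h1 : ε ≤ Real.pi / 2)
    (h : Real.cos (2 * ε) ≤ w.re) : ∃ t : ℝ, |t| ≤ ε ∧ w = Complex.exp (2 * t * Complex.I) := by
  have hn : ‖w‖ = 1 := by
    rw [Complex.normSq_eq_norm_sq] at hw
    nlinarith [norm_nonneg w]
  refine ⟨w.arg / 2, ?_, ?_⟩
  · have hw0 : w ≠ 0 := by intro h; simp [h] at hn
    have h2 := Complex.cos_arg hw0
    rw [hn, div_one, ← Real.cos_abs] at h2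
    by_contra! h3
    rw [abs_div, abs_two] at h3
    have := Real.cos_lt_cos_of_nonneg_of_le_pi (x := 2 * ε) (y := |w.arg|) (by linarith)
      (Complex.abs_arg_le_pi w) (by linarith)
    linarith
  · have := Complex.norm_mul_exp_arg_mul_I w
    rw [hn] at this
    rw [Complex.ofReal_one, one_mul] at this
    conv_lhs => rw [← this]
    congr 1
    push_cast; ring

lemma multiset_bound {α : Type*} (s : Multiset α) (f g h : α → ℝ) (c : ℝ) (hc : 0 ≤ c)
    (hf : ∀ x, 0 ≤ f x) (hg : ∀ x, 0 ≤ g x) (hh : ∀ x, 0 ≤ h x)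
    (H : ∀ x ∈ s, f x * g x ≤ c * h x ^ 2) :
    (s.map f).prod * (s.map g).prod ≤ c ^ s.card * (s.map h).prod ^ 2 := by
  induction s using Multiset.induction with
  | empty => simp
  | cons a s ih =>
    have i1 := ih (fun x hx => H x (Multiset.mem_cons_of_mem hx))
    have i2 := H a (Multiset.mem_cons_self _ _)
    have p1 : 0 ≤ (s.map f).prod := Multiset.prod_nonneg (by simp only [Multiset.mem_map]; rintro _ ⟨x, -, rfl⟩; exact hf x)
    have p2 : 0 ≤ (s.map g).prod := Multiset.prod_nonneg (by simp only [Multiset.mem_map]; rintro _ ⟨x, -, rfl⟩; exact hg x)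
    simp only [Multiset.map_cons, Multiset.prod_cons, Multiset.card_cons]
    calc f a * (s.map f).prod * (g a * (s.map g).prod)
        = (f a * g a) * ((s.map f).prod * (s.map g).prod) := by ring
      _ ≤ (c * h a ^ 2) * (c ^ s.card * (s.map h).prod ^ 2) := by
        apply mul_le_mul i2 i1 (mul_nonneg p1 p2)
        have := hh a
        positivity
      _ = _ := by ring

lemma trf_key (C : ℕ → SL2) (q : ℕ) (hq : 1 ≤ q) (ε : ℝ) (h0 : 0 < ε) (h1 : ε ≤ Real.pi / 2)
    (H : ∀ t, |t| ≤ ε → 2 ≤ |trf C q t|) :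
    4 ≤ (Real.cos ε ^ 2) ^ q * trf C q 0 ^ 2 := by
  set P := tpol C q with hP
  have hdeg : P.natDegree = q := tpol_natDegree C q hq
  have hsp : P.Splits := IsAlgClosed.splits P
  have hcard : P.roots.card = q := by rw [← hdeg]; exact hsp.natDegree_eq_card_roots.symm
  have hev : ∀ z : ℂ, ‖P.eval z‖ = ‖P.leadingCoeff‖ * (P.roots.map (fun a => ‖z - a‖)).prod := by
    intro z
    conv_lhs => rw [hsp.eval_eq_prod_roots]
    rw [norm_mul]
    congr 1
    have := map_multiset_prod (normHom : ℂ →*₀ ℝ) (P.roots.map (fun x => z - x))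
    rw [Multiset.map_map] at this
    exact this
  have hroot : ∀ w ∈ P.roots, Complex.normSq w = 1 ∧ w.re < Real.cos (2 * ε) := by
    intro w hw
    have hw0 : P.eval w = 0 := (Polynomial.mem_roots'.1 hw).2
    have hu := root_unimod C w q hq hw0
    refine ⟨hu, ?_⟩
    by_contra! hre
    obtain ⟨t, ht, rfl⟩ := root_angle w hu ε h0 h1 hre
    have := trf_abs C q t
    rw [← hP, hw0, norm_zero] at this
    have := H t ht
    linarith
  have hb := multiset_bound P.roots (fun a => ‖Complex.exp (2 * ε * Complex.I) - a‖)
    (fun a => ‖Complex.exp (2 * (-ε : ℝ) * Complex.I) - a‖)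
    (fun a => ‖Complex.exp (2 * (0 : ℝ) * Complex.I) - a‖) (Real.cos ε ^ 2) (sq_nonneg _)
    (fun _ => norm_nonneg _) (fun _ => norm_nonneg _) (fun _ => norm_nonneg _)
    (fun w hw => root_factor w (hroot w hw).1 ε (hroot w hw).2)
  have a1 := trf_abs C q ε
  have a2 := trf_abs C q (-ε)
  have a3 := trf_abs C q 0
  rw [← hP, hev] at a1 a2 a3
  rw [hcard] at hb
  have b1 := H ε (by rw [abs_of_pos h0])
  have b2 := H (-ε) (by rw [abs_neg, abs_of_pos h0])
  rw [← sq_abs (trf C q 0), ← a3, mul_pow]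
  have hl := sq_nonneg ‖P.leadingCoeff‖
  calc (4 : ℝ) = 2 * 2 := by norm_num
    _ ≤ |trf C q ε| * |trf C q (-ε)| := by gcongr
    _ = ‖P.leadingCoeff‖ ^ 2 * ((P.roots.map (fun a => ‖Complex.exp (2 * ε * Complex.I) - a‖)).prod *
       (P.roots.map (fun a => ‖Complex.exp (2 * (-ε : ℝ) * Complex.I) - a‖)).prod) := by
        rw [← a1, ← a2]; ring
    _ ≤ _ := by
      refine (mul_le_mul_of_nonneg_left hb hl).trans (le_of_eq ?_); ring

lemma trf_nonconst (C : ℕ → SL2) (q : ℕ) (hq : 1 ≤ q) (ε : ℝ) (h0 : 0 < ε) (h1 : ε ≤ Real.pi / 2)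
    (c : ℝ) : ∃ t, |t| ≤ ε ∧ trf C q t ≠ c := by
  by_contra! H
  set P := tpol C q with hP
  have hinj : Set.InjOn (fun t : ℝ => Complex.exp (2 * t * Complex.I)) (Set.Ioo 0 ε) := by
    intro s hs t ht hst
    simp only at hst
    have e1 : ∀ s : ℝ, (Complex.exp (2 * s * Complex.I)).re = Real.cos (2 * s) := by
      intro s
      have : (2 * s * Complex.I : ℂ) = ((2 * s : ℝ) : ℂ) * Complex.I := by push_cast; ring
      rw [this, Complex.exp_ofReal_mul_I_re]
    have := congrArg Complex.re hst
    rw [e1, e1] at this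
    have := Real.injOn_cos ⟨by linarith [hs.1], by linarith [hs.2]⟩ ⟨by linarith [ht.1], by linarith [ht.2]⟩ this
    linarith
  have hinf : ((fun t : ℝ => Complex.exp (2 * t * Complex.I)) '' Set.Ioo 0 ε).Infinite :=
    (Set.infinite_image_iff hinj).2 (Set.Ioo_infinite h0)
  have heq : P ^ 2 = Polynomial.C ((c : ℂ) ^ 2) * Polynomial.X ^ q := by
    apply Polynomial.eq_of_infinite_eval_eq
    apply hinf.mono
    rintro _ ⟨t, ht, rfl⟩
    have := trf_eq C q t
    rw [H t (by rw [abs_of_pos ht.1]; exact ht.2.le)] at this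
    simp only [Set.mem_ofPred_eq, Polynomial.eval_pow, Polynomial.eval_mul, Polynomial.eval_C, Polynomial.eval_X]
    rw [this, mul_pow, ← Complex.exp_nat_mul, ← Complex.exp_nat_mul, mul_comm]
    congr 2
    push_cast; ring
  have h2 := congrArg (Polynomial.eval 0) heq
  simp only [Polynomial.eval_pow, Polynomial.eval_mul, Polynomial.eval_C, Polynomial.eval_X,
    zero_pow (by omega : q ≠ 0), mul_zero] at h2
  have h3 := root_unimod C 0 q hq (by simpa using h2)
  simp at h3

lemma cprod_continuous (C : ℕ → SL2) (q : ℕ) : Continuous (fun t => cprod (fun j => C j * rot t) q) := by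
  induction q with
  | zero => exact continuous_const
  | succ n ih => exact continuous_SL2_mul (continuous_SL2_mul continuous_const continuous_rot) ih

lemma trf_continuous (C : ℕ → SL2) (q : ℕ) : Continuous (trf C q) := by
  have := continuous_coe_SL2.comp (cprod_continuous C q)
  exact (this.matrix_elem 0 0).add (this.matrix_elem 1 1)

lemma tr2_le (g : SL2) : |tr2 g| ≤ 2 * ‖toEuc g‖ := by
  have h : ∀ i : Fin 2, |(g : Mat2) i i| ≤ ‖toEuc g‖ := by
    intro i
    have h1 : (g : Mat2) i i = (toEuc g (EuclideanSpace.single i 1)) i := by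
      fin_cases i
      · simp [toEuc_zero_coord]
      · simp [toEuc_one_coord]
    rw [h1, ← Real.norm_eq_abs]
    refine (PiLp.norm_apply_le _ i).trans ?_
    refine ((toEuc g).le_opNorm _).trans ?_
    simp
  have := h 0; have := h 1
  exact (abs_add_le _ _).trans (by linarith)

lemma elliptic_pow (P : SL2) (φ : ℝ) (h : tr2 P = 2 * Real.cos φ) (n : ℕ) :
    Real.sin φ • ((P ^ n : SL2) : Mat2) = Real.sin (n * φ) • (P : Mat2) - Real.sin (n * φ - φ) • (1 : Mat2) := by
  have hCH : (P : Mat2) * (P : Mat2) = (2 * Real.cos φ) • (P : Mat2) - (1 : Mat2) := by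
    have hd := SL2_det P
    rw [← h, tr2]
    ext i j
    fin_cases i <;> fin_cases j <;> simp [Matrix.mul_apply, Fin.sum_univ_two] <;> linarith
  induction n with
  | zero => simp [Real.sin_neg]
  | succ n ih =>
    rw [pow_succ, Matrix.SpecialLinearGroup.coe_mul, ← Matrix.smul_mul, ih, Matrix.sub_mul, Matrix.smul_mul, hCH,
      Matrix.smul_mul, one_mul]
    have e1 : ((n + 1 : ℕ) : ℝ) * φ - φ = n * φ := by push_cast; ring
    have e2 : ((n + 1 : ℕ) : ℝ) * φ = n * φ + φ := by push_cast; ring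
    rw [e1, e2, Real.sin_add, Real.sin_sub, smul_sub, smul_smul, sub_right_comm, ← sub_smul]
    congr 2
    ring

/-- Elliptic closing for products. -/
lemma elliptic_closing (C : ℕ → SL2) (q : ℕ) (hq : 1 ≤ q) (ε : ℝ) (h0 : 0 < ε) (h1 : ε ≤ Real.pi / 2)
    (hC : ‖toEuc (cprod C q)‖ * Real.cos ε ^ q < 1) :
    ∃ t b, |t| ≤ ε ∧ 1 ≤ b ∧ (cprod (fun j => C j * rot t) q) ^ (b : ℕ) = 1 := by
  obtain ⟨t0, ht0, hT0⟩ : ∃ t, |t| ≤ ε ∧ |trf C q t| < 2 := by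
    by_contra! H
    have hk := trf_key C q hq ε h0 h1 H
    have h2 : trf C q 0 = tr2 (cprod C q) := by simp [trf, rot_zero]
    have hc : 0 ≤ Real.cos ε := Real.cos_nonneg_of_neg_pi_div_two_le_of_le (by linarith) h1
    have h3 := tr2_le (cprod C q)
    rw [h2, ← sq_abs (tr2 _)] at hk
    have : Real.cos ε ^ q * |tr2 (cprod C q)| < 2 := by
      have : Real.cos ε ^ q * |tr2 (cprod C q)| ≤ Real.cos ε ^ q * (2 * ‖toEuc (cprod C q)‖) := by gcongr
      linarith
    have h4 : (Real.cos ε ^ 2) ^ q * |tr2 (cprod C q)| ^ 2 = (Real.cos ε ^ q * |tr2 (cprod C q)|) ^ 2 := by ring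
    rw [h4] at hk
    have : 0 ≤ Real.cos ε ^ q * |tr2 (cprod C q)| := by positivity
    nlinarith
  obtain ⟨t1, ht1, hT1⟩ := trf_nonconst C q hq ε h0 h1 (trf C q t0)
  -- an open interval of values
  obtain ⟨s1, s2, hs, hs1, hs2, hval⟩ : ∃ s1 s2 : ℝ, s1 < s2 ∧ -2 ≤ s1 ∧ s2 ≤ 2 ∧
      ∀ s, s1 < s → s < s2 → ∃ t, |t| ≤ ε ∧ trf C q t = s := by
    have hconn : (trf C q '' Set.Icc (-ε) ε).OrdConnected :=
      (isPreconnected_Icc.image _ (trf_continuous C q).continuousOn).ordConnected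
    have m0 : trf C q t0 ∈ trf C q '' Set.Icc (-ε) ε := ⟨t0, abs_le.1 ht0, rfl⟩
    have m1 : trf C q t1 ∈ trf C q '' Set.Icc (-ε) ε := ⟨t1, abs_le.1 ht1, rfl⟩
    obtain ⟨l0, l1⟩ := abs_lt.1 hT0
    rcases lt_or_gt_of_ne hT1 with hlt | hlt
    · refine ⟨max (-2) (trf C q t1), trf C q t0, max_lt l0 hlt, le_max_left _ _, l1.le, ?_⟩
      intro s ha hb
      obtain ⟨t, ht, rfl⟩ := hconn.out m1 m0 ⟨(lt_of_le_of_lt (le_max_right _ _) ha).le, hb.le⟩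
      exact ⟨t, abs_le.2 ht, rfl⟩
    · refine ⟨trf C q t0, min 2 (trf C q t1), lt_min l1 hlt, l0.le, min_le_left _ _, ?_⟩
      intro s ha hb
      obtain ⟨t, ht, rfl⟩ := hconn.out m0 m1 ⟨ha.le, (lt_of_lt_of_le hb (min_le_right _ _)).le⟩
      exact ⟨t, abs_le.2 ht, rfl⟩
  have hpi := Real.pi_pos
  have hacos : Real.arccos (s2 / 2) < Real.arccos (s1 / 2) :=
    Real.strictAntiOn_arccos ⟨by linarith, by linarith⟩ ⟨by linarith, by linarith⟩ (by linarith)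
  obtain ⟨r, hr1, hr2⟩ := exists_rat_btwn (div_lt_div_of_pos_right hacos hpi)
  set φ : ℝ := r * Real.pi with hφ
  have hφ1 : Real.arccos (s2 / 2) < φ := by rwa [div_lt_iff₀ hpi] at hr1
  have hφ2 : φ < Real.arccos (s1 / 2) := by rwa [lt_div_iff₀ hpi] at hr2
  have hφ0 : 0 < φ := lt_of_le_of_lt (Real.arccos_nonneg _) hφ1
  have hφπ : φ < Real.pi := lt_of_lt_of_le hφ2 (Real.arccos_le_pi _)
  have hc1 : 2 * Real.cos φ < s2 := by
    have := Real.cos_lt_cos_of_nonneg_of_le_pi (Real.arccos_nonneg _) hφπ.le hφ1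
    rw [Real.cos_arccos (by linarith) (by linarith)] at this
    linarith
  have hc2 : s1 < 2 * Real.cos φ := by
    have := Real.cos_lt_cos_of_nonneg_of_le_pi hφ0.le (Real.arccos_le_pi _) hφ2
    rw [Real.cos_arccos (by linarith) (by linarith)] at this
    linarith
  obtain ⟨t, ht, htr⟩ := hval _ hc2 hc1
  refine ⟨t, 2 * r.den, ht, ?_, ?_⟩
  · have := r.den_pos; omega
  · have hp := elliptic_pow _ φ htr (2 * r.den)
    have hs := Real.sin_pos_of_pos_of_lt_pi hφ0 hφπ
    have hn : ((2 * r.den : ℕ) : ℝ) * φ = (r.num : ℝ) * (2 * Real.pi) := by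
      have : (r.den : ℝ) * (r : ℝ) = r.num := by
        rw [mul_comm]; exact_mod_cast Rat.mul_den_eq_num r
      rw [hφ, ← this]; push_cast; ring
    have e1 : Real.sin ((r.num : ℝ) * (2 * Real.pi)) = 0 := by
      have := Real.sin_int_mul_pi (2 * r.num)
      rw [← this]; congr 1; push_cast; ring
    have e2 : Real.sin ((r.num : ℝ) * (2 * Real.pi) - φ) = - Real.sin φ := by
      have h := Real.sin_sub_int_mul_two_pi φ (r.num)
      rw [← neg_sub, Real.sin_neg, h]
    rw [hn, e1, e2] at hp
    ext i j
    have := congrFun (congrFun hp i) j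
    simp only [Matrix.smul_apply, Matrix.sub_apply, smul_eq_mul, zero_mul, zero_sub, neg_mul, neg_neg] at this
    exact mul_left_cancel₀ hs.ne' this

/-! ### Windows and closing -/

section windows
variable {κ : ℕ}

def Agree (k : ℕ) (x x' : Sig κ) : Prop := ∀ i : ℤ, |i| ≤ k → x i = x' i

def Win {α : Type*} (k : ℕ) (f : Sig κ → α) : Prop := ∀ x x', Agree k x x' → f x = f x'

lemma Agree.symm {k : ℕ} {x x' : Sig κ} (h : Agree k x x') : Agree k x' x := fun i hi => (h i hi).symm
lemma Agree.trans {k : ℕ} {x y z : Sig κ} (h : Agree k x y) (h' : Agree k y z) : Agree k x z :=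
  fun i hi => (h i hi).trans (h' i hi)
lemma Agree.mono {k l : ℕ} {x x' : Sig κ} (h : Agree l x x') (hkl : k ≤ l) : Agree k x x' :=
  fun i hi => h i (hi.trans (by exact_mod_cast hkl))
lemma Win.mono {α : Type*} {k l : ℕ} {f : Sig κ → α} (h : Win k f) (hkl : k ≤ l) : Win l f :=
  fun x x' hx => h x x' (hx.mono hkl)

lemma isOpen_agree (k : ℕ) (x : Sig κ) : IsOpen {x' | Agree k x x'} := by
  have : {x' : Sig κ | Agree k x x'} = ⋂ i ∈ Finset.Icc (-(k:ℤ)) k, (fun x' : Sig κ => x' i) ⁻¹' {x i} := by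
    ext x'
    simp only [Agree, Set.mem_ofPred_eq, Set.mem_iInter, Finset.mem_Icc, abs_le, Set.mem_preimage,
      Set.mem_singleton_iff, eq_comm]
  rw [this]
  exact isOpen_biInter_finset fun i _ => (isOpen_discrete _).preimage (continuous_apply i)

lemma nhds_agree (x : Sig κ) (U : Set (Sig κ)) (hU : U ∈ nhds x) : ∃ k, ∀ x', Agree k x x' → x' ∈ U := by
  obtain ⟨V, hVU, hV, hxV⟩ := mem_nhds_iff.1 hU
  obtain ⟨I, u, h1, h2⟩ := isOpen_pi_iff.1 hV x hxV
  refine ⟨∑ i ∈ I, i.natAbs, fun x' hx' => hVU (h2 ?_)⟩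
  intro i hi
  rw [← hx' i]
  · exact (h1 i hi).2
  · rw [Int.abs_eq_natAbs]
    have := Finset.single_le_sum (f := fun i : ℤ => i.natAbs) (fun _ _ => Nat.zero_le _) (Finset.mem_coe.1 hi)
    exact_mod_cast this

lemma Win.continuous {α : Type*} [TopologicalSpace α] {k : ℕ} {f : Sig κ → α} (h : Win k f) :
    Continuous f := by
  rw [continuous_iff_continuousAt]
  intro x
  apply ContinuousAt.congr (f := fun _ => f x) continuousAt_const
  filter_upwards [(isOpen_agree k x).mem_nhds (show Agree k x x from fun _ _ => rfl)] with x' hx'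
  exact h x x' hx'

lemma unif_window (A : Sig κ → SL2) (hA : Continuous A) (ε : ℝ) (hε : 0 < ε) :
    ∃ k, ∀ x x', Agree k x x' → ‖toEuc (A x) - toEuc (A x')‖ < ε := by
  have hc : Continuous (fun x => toEuc (A x)) := continuous_toEuc.comp hA
  have h1 : ∀ x, ∃ k, ∀ x', Agree k x x' → ‖toEuc (A x') - toEuc (A x)‖ < ε / 2 := by
    intro x
    apply nhds_agree x {x' | ‖toEuc (A x') - toEuc (A x)‖ < ε / 2}
    have := Metric.continuousAt_iff'.1 (hc.continuousAt (x := x)) (ε / 2) (by positivity)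
    simp only [dist_eq_norm] at this
    exact this
  choose k hk using h1
  obtain ⟨s, hs⟩ := isCompact_univ.elim_finite_subcover (fun x => {x' | Agree (k x) x x'})
    (fun x => isOpen_agree _ _) (fun x _ => Set.mem_iUnion.2 ⟨x, fun _ _ => rfl⟩)
  refine ⟨∑ x ∈ s, k x, fun x x' hx => ?_⟩
  obtain ⟨z, hz, hzx⟩ : ∃ z ∈ s, Agree (k z) z x := by
    have := hs (Set.mem_univ x)
    simpa using this
  have hle : k z ≤ ∑ x ∈ s, k x := Finset.single_le_sum (fun _ _ => Nat.zero_le _) hz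
  have a1 := hk z x hzx
  have a2 := hk z x' (hzx.trans (hx.mono hle))
  calc ‖toEuc (A x) - toEuc (A x')‖ = ‖(toEuc (A x) - toEuc (A z)) - (toEuc (A x') - toEuc (A z))‖ := by
        congr 1; abel
    _ ≤ ‖toEuc (A x) - toEuc (A z)‖ + ‖toEuc (A x') - toEuc (A z)‖ := norm_sub_le _ _
    _ < ε := by linarith

/-- truncation -/
def trunc (k : ℕ) (z : Sig κ) : Sig κ := fun i => if |i| ≤ k then z i else z 0

lemma agree_trunc (k : ℕ) (z : Sig κ) : Agree k z (trunc k z) := fun i hi => by simp [trunc, hi]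

lemma win_trunc (k : ℕ) : Win k (trunc k : Sig κ → Sig κ) := by
  intro x x' h
  funext i
  simp only [trunc]
  split_ifs with hi
  · exact h i hi
  · exact h 0 (by simp)

lemma period_divisor (f : ℤ → Fin κ) (q d : ℕ) (hq : Function.Periodic f (q : ℤ))
    (hd : Function.Periodic f (d : ℤ)) : Function.Periodic f ((Nat.gcd d q : ℕ) : ℤ) := by
  rw [Nat.gcd_eq_gcd_ab]
  have h1 := hd.int_mul (Nat.gcdA d q)
  have h2 := hq.int_mul (Nat.gcdB d q)
  have := h1.add_period h2
  rwa [mul_comm (d : ℤ), mul_comm (q : ℤ)]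

/-- A word can be completed by one letter to a primitive periodic sequence. -/
lemma primitive_completion (hκ : 2 ≤ κ) (u : ℤ → Fin κ) (q : ℕ) (hq : 1 ≤ q) :
    ∃ y : ℤ → Fin κ, Function.Periodic y (q : ℤ) ∧ (∀ i : ℤ, 0 ≤ i → i < q - 1 → y i = u i) ∧
      ∀ d : ℕ, 0 < d → d < q → ¬ Function.Periodic y (d : ℤ) := by
  by_contra! H
  let Y : Fin κ → ℤ → Fin κ := fun a i => if i % q < q - 1 then u (i % q) else a
  have hq0 : (0 : ℤ) < q := by exact_mod_cast hq
  have hper : ∀ a, Function.Periodic (Y a) (q : ℤ) := by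
    intro a i
    simp [Y]
  have hY : ∀ a i, 0 ≤ i → i < (q : ℤ) - 1 → Y a i = u i := by
    intro a i h0 h1
    have : i % q = i := Int.emod_eq_of_lt h0 (by omega)
    simp [Y, this, h1]
  have hYa : ∀ a, Y a (q - 1) = a := by
    intro a
    have : ((q : ℤ) - 1) % q = q - 1 := Int.emod_eq_of_lt (by omega) (by omega)
    simp [Y, this]
  have hdiv : ∀ a, ∃ d : ℕ, 0 < d ∧ d < q ∧ d ∣ q ∧ Function.Periodic (Y a) (d : ℤ) := by
    intro a
    obtain ⟨d, h1, h2, h3⟩ := H (Y a) (hper a) (hY a)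
    refine ⟨Nat.gcd d q, Nat.gcd_pos_of_pos_left _ h1, ?_, Nat.gcd_dvd_right _ _, period_divisor _ _ _ (hper a) h3⟩
    exact lt_of_le_of_lt (Nat.le_of_dvd h1 (Nat.gcd_dvd_left _ _)) h2
  have hback : ∀ a (d : ℕ), Function.Periodic (Y a) (d : ℤ) → ∀ i : ℤ, Y a (i - d) = Y a i := by
    intro a d h i
    exact h.sub_eq i
  let a : Fin κ := ⟨0, by omega⟩
  let b : Fin κ := ⟨1, by omega⟩
  have hab : a ≠ b := by simp [a, b]
  obtain ⟨d, d0, d1, ⟨m, dq⟩, dp⟩ := hdiv a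
  obtain ⟨e, e0, e1, ⟨l, eq⟩, ep⟩ := hdiv b
  have hm : 2 ≤ m := by
    by_contra! hm
    interval_cases m <;> omega
  have hl : 2 ≤ l := by
    by_contra! hl
    interval_cases l <;> omega
  have hd2 : 2 * d ≤ q := by nlinarith
  have he2 : 2 * e ≤ q := by nlinarith
  apply hab
  have A1 := hback a d dp (q - 1)
  have B1 := hback b e ep (q - 1)
  rw [hYa] at A1 B1
  rw [hY a _ (by omega) (by omega)] at A1
  rw [hY b _ (by omega) (by omega)] at B1
  by_cases hde : d = e
  · subst hde
    rw [← A1, ← B1]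
  · have A2 := hback a d dp (q - 1 - e)
    have B2 := hback b e ep (q - 1 - d)
    rw [hY _ _ (by omega) (by omega), hY _ _ (by omega) (by omega)] at A2 B2
    rw [← A1, ← B1, ← A2, ← B2]
    congr 1; omega

lemma sh_nat_periodic (y : Sig κ) (q : ℕ) (h : Function.Periodic y (q : ℤ)) : sh q y = y := by
  funext i; exact h i

lemma cprod_congr {C C' : ℕ → SL2} {n : ℕ} (h : ∀ j < n, C j = C' j) : cprod C n = cprod C' n := by
  induction n with
  | zero => rfl
  | succ n ih => rw [cprod, cprod, h n (by omega), ih fun j hj => h j (by omega)]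

lemma coc_eq_cprod (A : Sig κ → SL2) (n : ℕ) (x : Sig κ) :
    coc shift A n x = cprod (fun j => A (sh j x)) n := by
  induction n with
  | zero => rfl
  | succ n ih => rw [coc_succ', ih, cprod, shift_iter]

lemma cprod_norm (C : ℕ → SL2) (K : ℝ) (hK : ∀ j, ‖toEuc (C j)‖ ≤ K) (n m : ℕ) :
    ‖toEuc (cprod C (n + m))‖ ≤ ‖toEuc (cprod C n)‖ * K ^ m := by
  have hK0 : 0 ≤ K := (norm_nonneg _).trans (hK 0)
  induction m with
  | zero => simp
  | succ m ih =>
    rw [← add_assoc, cprod]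
    refine (nmul_le _ _).trans ?_
    calc _ ≤ K * (‖toEuc (cprod C n)‖ * K ^ m) := mul_le_mul (hK _) ih (norm_nonneg _) hK0
      _ = _ := by ring

lemma coc_periodic (B : Sig κ → SL2) (q b : ℕ) (y : Sig κ) (hy : sh q y = y) :
    coc shift B (b * q) y = (coc shift B q y) ^ b := by
  induction b with
  | zero => simp [coc]
  | succ b ih =>
    rw [add_mul, one_mul, coc_add, shift_iter, hy, ih, pow_succ]

lemma sh_mul_period (q b : ℕ) (y : Sig κ) (hy : sh q y = y) : sh ((b * q : ℕ) : ℤ) y = y := by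
  induction b with
  | zero => simp [sh_zero]
  | succ b ih =>
    have : (((b + 1) * q : ℕ) : ℤ) = ((b * q : ℕ) : ℤ) + q := by push_cast; ring
    rw [this, ← sh_sh, hy, ih]

lemma orbit_sep (y : Sig κ) (q : ℕ) (hd : ∀ d : ℕ, 0 < d → d < q → ¬ Function.Periodic y (d : ℤ)) :
    ∃ k, ∀ i < q, ∀ j < q, Agree k (sh i y) (sh j y) → i = j := by
  have h1 : ∀ i j : ℕ, ∃ k : ℕ, i < q → j < q → Agree k (sh i y) (sh j y) → i = j := by
    intro i j
    by_cases hij : i = j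
    · exact ⟨0, fun _ _ _ => hij⟩
    · by_cases hq : i < q ∧ j < q
      · have : sh i y ≠ sh j y := by
          intro h
          rcases lt_or_gt_of_ne hij with hlt | hlt
          · apply hd (j - i) (by omega) (by omega)
            intro l
            have := congrFun h (l - i)
            simp only [sh_apply] at this
            rw [show l - i + i = l by ring] at this
            rw [this]; congr 1; push_cast [hlt.le]; ring
          · apply hd (i - j) (by omega) (by omega)
            intro l
            have := congrFun h (l - j)
            simp only [sh_apply] at this
            rw [show l - j + j = l by ring] at this
            rw [← this]; congr 1; push_cast [hlt.le]; ring
        obtain ⟨l, hl⟩ := Function.ne_iff.1 this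
        exact ⟨l.natAbs, fun _ _ h => absurd (h l (by rw [Int.abs_eq_natAbs])) hl⟩
      · exact ⟨0, fun a b => absurd ⟨a, b⟩ hq⟩
  choose N hN using h1
  refine ⟨∑ i ∈ Finset.range q, ∑ j ∈ Finset.range q, N i j, fun i hi j hj h => hN i j hi hj (h.mono ?_)⟩
  calc N i j ≤ ∑ j ∈ Finset.range q, N i j :=
        Finset.single_le_sum (f := fun j => N i j) (fun _ _ => Nat.zero_le _) (Finset.mem_range.2 hj)
    _ ≤ _ := Finset.single_le_sum (f := fun i => ∑ j ∈ Finset.range q, N i j)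
        (fun _ _ => Nat.zero_le _) (Finset.mem_range.2 hi)

open Classical in
theorem closing (hκ : 2 ≤ κ) (A : Sig κ → SL2) (hA : Continuous A) (hN : ¬ UniformlyHyperbolic A)
    (ε : ℝ) (hε : 0 < ε) : ∃ (B : Sig κ → SL2) (k : ℕ) (y : Sig κ) (n : ℕ), Win k B ∧
      (∀ x, ‖toEuc (A x) - toEuc (B x)‖ < ε) ∧ 1 ≤ n ∧ sh n y = y ∧ coc shift B n y = 1 := by
  obtain ⟨K, hK1, hK⟩ := exists_bound A hA
  have hK0 : 0 < K := by linarith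
  obtain ⟨r, hr0, hr⟩ := exists_rot_small (ε / (4 * K)) (by positivity)
  set δ := min r (Real.pi / 4) with hδ
  have hpi := Real.pi_pos
  have hδ0 : 0 < δ := lt_min hr0 (by positivity)
  have hδ1 : δ ≤ Real.pi / 4 := min_le_right _ _
  have hcos : 0 < Real.cos δ := Real.cos_pos_of_mem_Ioo ⟨by linarith, by linarith⟩
  have hcos1 : Real.cos δ < 1 := by
    rw [← Real.cos_zero]
    exact Real.cos_lt_cos_of_nonneg_of_le_pi le_rfl (by linarith) hδ0
  obtain ⟨k, hk⟩ := unif_window A hA (ε / 4) (by positivity)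
  obtain ⟨x, n, hxn⟩ := growth_fails A hA hN (c := (K ^ (2 * k + 1))⁻¹) (a := (Real.cos δ)⁻¹)
    (by positivity) ((one_lt_inv₀ hcos).2 hcos1)
  set q := n + (2 * k + 1) with hq
  obtain ⟨y0, hy0, hy0u, hy0d⟩ := primitive_completion hκ (sh (-k) x) q (by omega)
  set y : Sig κ := sh k y0 with hy
  have hyper : Function.Periodic y (q : ℤ) := by
    intro i; simp only [hy, sh_apply]
    rw [add_right_comm]; exact hy0 _
  have hyx : ∀ i : ℤ, -k ≤ i → i < n + k → y i = x i := by
    intro i h1 h2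
    simp only [hy, sh_apply]
    rw [hy0u _ (by omega) (by push_cast [hq]; omega), sh_apply]
    congr 1; ring
  have hyd : ∀ d : ℕ, 0 < d → d < q → ¬ Function.Periodic y (d : ℤ) := by
    intro d h1 h2 h3
    apply hy0d d h1 h2
    intro i
    have := h3 (i - k)
    simp only [hy, sh_apply] at this
    rw [show i - k + k = i by ring, show i - k + d + k = i + d by ring] at this
    exact this
  set C : ℕ → SL2 := fun j => if j < n then A (sh j x) else A (sh j y) with hC
  have hCK : ∀ j, ‖toEuc (C j)‖ ≤ K := by
    intro j; simp only [hC]; split_ifs <;> exact hK _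
  have hCA : ∀ j < q, ‖toEuc (A (sh j y)) - toEuc (C j)‖ < ε / 4 := by
    intro j hj
    simp only [hC]
    split_ifs with h
    · apply hk
      intro i hi
      rw [abs_le] at hi
      simp only [sh_apply]
      exact hyx _ (by omega) (by omega)
    · simp; exact hε
  have hCprod : ‖toEuc (cprod C q)‖ * Real.cos δ ^ q < 1 := by
    have h1 := cprod_norm C K hCK n (2 * k + 1)
    have h2 : cprod C n = coc shift A n x := by
      rw [coc_eq_cprod]; exact cprod_congr fun j hj => by simp [hC, hj]
    rw [h2, ← hq] at h1
    have h3 : ‖toEuc (cprod C q)‖ < (Real.cos δ)⁻¹ ^ n := by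
      refine lt_of_le_of_lt h1 ?_
      have : 0 < K ^ (2 * k + 1) := by positivity
      calc _ < (K ^ (2 * k + 1))⁻¹ * (Real.cos δ)⁻¹ ^ n * K ^ (2 * k + 1) := by gcongr
        _ = _ := by field_simp
    have h4 : Real.cos δ ^ q ≤ Real.cos δ ^ n := pow_le_pow_of_le_one hcos.le hcos1.le (by omega)
    calc _ ≤ ‖toEuc (cprod C q)‖ * Real.cos δ ^ n := by gcongr
      _ < (Real.cos δ)⁻¹ ^ n * Real.cos δ ^ n := by gcongr
      _ = 1 := by rw [← mul_pow, inv_mul_cancel₀ hcos.ne', one_pow]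
  obtain ⟨t, b, ht, hb, hP⟩ := elliptic_closing C q (by omega) δ hδ0 (by linarith) hCprod
  obtain ⟨k1, hk1⟩ := orbit_sep y q hyd
  set k' := max k k1 with hk'
  let B : Sig κ → SL2 := fun z => if h : ∃ j < q, Agree k' z (sh j y) then C (Classical.choose h) * rot t
    else A (trunc k' z)
  have hB1 : ∀ z j, j < q → Agree k' z (sh j y) → B z = C j * rot t := by
    intro z j hj hz
    have h : ∃ j < q, Agree k' z (sh j y) := ⟨j, hj, hz⟩
    have hs := Classical.choose_spec h
    have : Classical.choose h = j := by
      apply hk1 _ hs.1 _ hj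
      exact (hs.2.symm.trans hz).mono (le_max_right _ _)
    simp only [B, dif_pos h, this]
  have hB2 : ∀ z, (¬ ∃ j < q, Agree k' z (sh j y)) → B z = A (trunc k' z) := by
    intro z h
    simp only [B, dif_neg h]
  refine ⟨B, k', y, b * q, ?_, ?_, ?_, ?_, ?_⟩
  · intro z z' hz
    by_cases h : ∃ j < q, Agree k' z (sh j y)
    · obtain ⟨j, hj, hj'⟩ := h
      rw [hB1 z j hj hj', hB1 z' j hj (hz.symm.trans hj')]
    · have h' : ¬ ∃ j < q, Agree k' z' (sh j y) := by
        rintro ⟨j, hj, hj'⟩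
        exact h ⟨j, hj, hz.trans hj'⟩
      rw [hB2 z h, hB2 z' h', win_trunc k' z z' hz]
  · intro z
    by_cases h : ∃ j < q, Agree k' z (sh j y)
    · obtain ⟨j, hj, hj'⟩ := h
      rw [hB1 z j hj hj', toEuc_mul]
      have e1 := hk z (sh j y) (hj'.mono (le_max_left _ _))
      have e2 := hCA j hj
      have e3 : ‖toEuc (C j) - toEuc (C j) * toEuc (rot t)‖ ≤ ε / 4 := by
        have : toEuc (C j) - toEuc (C j) * toEuc (rot t) = toEuc (C j) * -(toEuc (rot t) - 1) := by
          rw [neg_sub, mul_sub, mul_one]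
        rw [this]
        refine (norm_mul_le _ _).trans ?_
        rw [norm_neg]
        have := hr t (ht.trans (min_le_left _ _))
        calc _ ≤ K * (ε / (4 * K)) := mul_le_mul (hCK j) this.le (norm_nonneg _) hK0.le
          _ = ε / 4 := by field_simp
      calc ‖toEuc (A z) - toEuc (C j) * toEuc (rot t)‖
          = ‖(toEuc (A z) - toEuc (A (sh j y))) + (toEuc (A (sh j y)) - toEuc (C j)) +
            (toEuc (C j) - toEuc (C j) * toEuc (rot t))‖ := by congr 1; abel
        _ ≤ _ := norm_add₃_le
        _ < ε := by linarith
    · rw [hB2 z h]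
      exact (hk _ _ ((agree_trunc k' z).mono (le_max_left _ _))).trans (by linarith)
  · exact Nat.mul_pos hb (by omega)
  · exact sh_mul_period q b y (sh_nat_periodic y q hyper)
  · rw [coc_periodic _ _ _ _ (sh_nat_periodic y q hyper), coc_eq_cprod, ← hP]
    congr 1
    apply cprod_congr
    intro j hj
    exact hB1 _ j hj fun _ _ => rfl

end windows

/-! ### Bernoulli measure facts -/

section bern
variable {κ : ℕ}

/-- cylinders -/
def cyl (s : Finset ℤ) (a : ℤ → Fin κ) : Set (Sig κ) := {x | ∀ n ∈ s, x n = a n}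

lemma isOpen_cyl (s : Finset ℤ) (a : ℤ → Fin κ) : IsOpen (cyl s a) := by
  have : cyl s a = ⋂ i ∈ s, (fun x' : Sig κ => x' i) ⁻¹' {a i} := by
    ext x'
    simp only [cyl, Set.mem_ofPred_eq, Set.mem_iInter, Set.mem_preimage, Set.mem_singleton_iff]
  rw [this]
  exact isOpen_biInter_finset fun i _ => (isOpen_discrete _).preimage (continuous_apply i)

lemma measurableSet_cyl (s : Finset ℤ) (a : ℤ → Fin κ) : MeasurableSet (cyl s a) :=
  (isOpen_cyl s a).measurableSet

lemma generate_cyl : (MeasurableSpace.pi : MeasurableSpace (Sig κ)) =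
    MeasurableSpace.generateFrom {S | ∃ s a, S = cyl s a} := by
  apply le_antisymm
  · refine iSup_le fun n => ?_
    rw [← measurable_iff_comap_le]
    refine @measurable_to_countable' _ _ _ _ (MeasurableSpace.generateFrom {S | ∃ s a, S = cyl s a}) _ fun v => ?_
    apply MeasurableSpace.measurableSet_generateFrom
    refine ⟨{n}, fun _ => v, ?_⟩
    ext x; simp [cyl]
  · apply MeasurableSpace.generateFrom_le
    rintro _ ⟨s, a, rfl⟩
    exact measurableSet_cyl s a

lemma pi_cyl : IsPiSystem {S : Set (Sig κ) | ∃ s a, S = cyl s a} := by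
  rintro _ ⟨s, a, rfl⟩ _ ⟨s', a', rfl⟩ ⟨z, hz1, hz2⟩
  refine ⟨s ∪ s', z, ?_⟩
  ext x
  simp only [cyl, Set.mem_inter_iff, Set.mem_ofPred_eq, Finset.mem_union] at *
  constructor
  · rintro ⟨h1, h2⟩ n (hn | hn)
    · rw [h1 n hn, hz1 n hn]
    · rw [h2 n hn, hz2 n hn]
  · intro h
    exact ⟨fun n hn => by rw [h n (Or.inl hn), hz1 n hn], fun n hn => by rw [h n (Or.inr hn), hz2 n hn]⟩

variable {p : Fin κ → ℝ} {μ : Measure (Sig κ)}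

lemma bern_cyl (hμ : IsBernoulli p μ) (s : Finset ℤ) (a : ℤ → Fin κ) :
    μ (cyl s a) = ∏ n ∈ s, ENNReal.ofReal (p (a n)) := hμ.2 s a

lemma bern_cyl_real (hp : ∀ i, 0 < p i) (hμ : IsBernoulli p μ) (s : Finset ℤ) (a : ℤ → Fin κ) :
    μ.real (cyl s a) = ∏ n ∈ s, p (a n) := by
  rw [Measure.real, bern_cyl hμ, ENNReal.toReal_prod]
  exact Finset.prod_congr rfl fun n _ => ENNReal.toReal_ofReal (hp _).le

lemma sh_preserving (hμ : IsBernoulli p μ) (j : ℤ) : MeasurePreserving (sh j : Sig κ → Sig κ) μ μ := by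
  have := hμ.1
  refine ⟨(continuous_sh j).measurable, ?_⟩
  have hm : Measurable (sh j : Sig κ → Sig κ) := (continuous_sh j).measurable
  have : IsProbabilityMeasure (μ.map (sh j)) := Measure.isProbabilityMeasure_map hm.aemeasurable
  refine ext_of_generate_finite _ generate_cyl pi_cyl ?_ (by simp)
  rintro _ ⟨s, a, rfl⟩
  rw [Measure.map_apply hm (measurableSet_cyl s a)]
  have : sh j ⁻¹' (cyl s a) = cyl (s.image (· + j)) (fun m => a (m - j)) := by
    ext x
    simp only [cyl, sh_apply, Set.mem_preimage, Set.mem_ofPred_eq, Finset.mem_image]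
    constructor
    · rintro h _ ⟨n, hn, rfl⟩
      rw [h n hn]; congr 1; ring
    · intro h n hn
      rw [h _ ⟨n, hn, rfl⟩]; congr 1; ring
  rw [this, bern_cyl hμ, bern_cyl hμ, Finset.prod_image (fun a _ b _ h => by simpa using h)]
  exact Finset.prod_congr rfl fun n _ => by simp

/-- the word `a` of length `ℓ` occurs at position `s` -/
def Occ (a : ℤ → Fin κ) (ℓ : ℕ) (s : ℤ) (x : Sig κ) : Prop := ∀ i : ℤ, 0 ≤ i → i < ℓ → x (s + i) = a i

def occF (ℓ : ℕ) (s : ℤ) : Finset ℤ := Finset.Ico s (s + ℓ)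

lemma occ_eq (a : ℤ → Fin κ) (ℓ : ℕ) (s : ℤ) :
    {x | Occ a ℓ s x} = cyl (occF ℓ s) (fun m => a (m - s)) := by
  ext x
  simp only [Occ, cyl, occF, Set.mem_ofPred_eq, Finset.mem_Ico]
  constructor
  · intro h n hn
    rw [← h (n - s) (by omega) (by omega)]; congr 1; ring
  · intro h i h0 h1
    rw [h (s + i) (by omega)]; congr 1; ring

lemma occ_measure (hp : ∀ i, 0 < p i) (hμ : IsBernoulli p μ) (a : ℤ → Fin κ) (ℓ : ℕ) (s : ℤ) :
    μ.real {x | Occ a ℓ s x} = ∏ i ∈ occF ℓ 0, p (a i) := by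
  rw [occ_eq, bern_cyl_real hp hμ]
  refine Finset.prod_bij (fun m _ => m - s) ?_ ?_ ?_ ?_
  · intro m hm; simp only [occF, Finset.mem_Ico] at *; omega
  · intro m _ m' _ h; omega
  · intro m hm; refine ⟨m + s, ?_, by ring⟩; simp only [occF, Finset.mem_Ico] at *; omega
  · intro m _; rfl

lemma nonocc_step (hp : ∀ i, 0 < p i) (hμ : IsBernoulli p μ) (a : ℤ → Fin κ) (ℓ : ℕ) (J : ℕ) :
    ∀ (s : Finset ℤ) (b : ℤ → Fin κ), (∀ n ∈ s, n < 0 ∨ (J * ℓ : ℤ) ≤ n) →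
    μ.real ({x | ∀ j < J, ¬ Occ a ℓ (j * ℓ : ℤ) x} ∩ cyl s b) =
      (1 - ∏ i ∈ occF ℓ 0, p (a i)) ^ J * μ.real (cyl s b) := by
  have := hμ.1
  set c := ∏ i ∈ occF ℓ 0, p (a i) with hc
  induction J with
  | zero => intro s b _; simp
  | succ J ih =>
    intro s b hs
    set N := {x : Sig κ | ∀ j < J, ¬ Occ a ℓ (j * ℓ : ℤ) x} with hN
    have hNm : MeasurableSet N := by
      have : N = ⋂ j ∈ Finset.range J, {x | Occ a ℓ (j * ℓ : ℤ) x}ᶜ := by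
        ext x; simp [hN]
      rw [this]
      exact Finset.measurableSet_biInter _ fun j _ => by
        rw [occ_eq]; exact (measurableSet_cyl _ _).compl
    set O := {x : Sig κ | Occ a ℓ (J * ℓ : ℤ) x} with hO
    have hOm : MeasurableSet O := by rw [hO, occ_eq]; exact measurableSet_cyl _ _
    have e1 : {x : Sig κ | ∀ j < J + 1, ¬ Occ a ℓ (j * ℓ : ℤ) x} ∩ cyl s b = (N ∩ cyl s b) \ O := by
      ext x
      simp only [Set.mem_inter_iff, Set.mem_sdiff, hN, hO, Set.mem_ofPred_eq, Nat.lt_succ_iff_lt_or_eq]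
      constructor
      · rintro ⟨h1, h2⟩
        exact ⟨⟨fun j hj => h1 j (Or.inl hj), h2⟩, h1 J (Or.inr rfl)⟩
      · rintro ⟨⟨h1, h2⟩, h3⟩
        refine ⟨?_, h2⟩
        rintro j (hj | rfl)
        · exact h1 j hj
        · exact h3
    have hJl : ((J : ℤ) + 1) * ℓ = J * ℓ + ℓ := by ring
    have hJ0 : (0 : ℤ) ≤ J * ℓ := by positivity
    push_cast at hs
    rw [hJl] at hs
    have hs' : ∀ n ∈ s, n < 0 ∨ (J * ℓ : ℤ) ≤ n := by
      intro n hn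
      have := hs n hn; omega
    have hdisj : Disjoint s (occF ℓ (J * ℓ)) := by
      rw [Finset.disjoint_left]
      intro n hn hn'
      simp only [occF, Finset.mem_Ico] at hn'
      have := hs n hn
      omega
    let b' : ℤ → Fin κ := fun m => if m ∈ s then b m else a (m - J * ℓ)
    have e2 : (cyl s b) ∩ O = cyl (s ∪ occF ℓ (J * ℓ)) b' := by
      rw [hO, occ_eq]
      ext x
      simp only [cyl, Set.mem_inter_iff, Set.mem_ofPred_eq, Finset.mem_union, b']
      constructor
      · rintro ⟨h1, h2⟩ n (hn | hn)
        · simp [hn, h1 n hn]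
        · have : n ∉ s := fun h => (Finset.disjoint_left.1 hdisj h) hn
          simp [this, h2 n hn]
      · intro h
        refine ⟨fun n hn => by simpa [hn] using h n (Or.inl hn), fun n hn => ?_⟩
        have : n ∉ s := fun h => (Finset.disjoint_left.1 hdisj h) hn
        simpa [this] using h n (Or.inr hn)
    have e3 : μ.real (cyl (s ∪ occF ℓ (J * ℓ)) b') = μ.real (cyl s b) * c := by
      rw [bern_cyl_real hp hμ, Finset.prod_union hdisj, bern_cyl_real hp hμ]
      congr 1
      · exact Finset.prod_congr rfl fun n hn => by simp [b', hn]
      · rw [hc, ← occ_measure hp hμ a ℓ (J * ℓ), occ_eq, bern_cyl_real hp hμ]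
        refine Finset.prod_congr rfl fun n hn => ?_
        have : n ∉ s := fun h => (Finset.disjoint_left.1 hdisj h) hn
        simp [b', this]
    rw [e1]
    have e4 : μ.real ((N ∩ cyl s b) \ O) = μ.real (N ∩ cyl s b) - μ.real ((N ∩ cyl s b) ∩ O) := by
      have := measureReal_inter_add_sdiff (μ := μ) (s := N ∩ cyl s b) hOm
      linarith
    rw [e4, Set.inter_assoc, e2, ih s b hs', ih _ b' ?_, e3]
    · ring
    · intro n hn
      rcases Finset.mem_union.1 hn with hn | hn
      · exact hs' n hn
      · simp only [occF, Finset.mem_Ico] at hn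
        omega

lemma exists_rho (hκ : 2 ≤ κ) (hp : ∀ i, 0 < p i) (hp1 : ∑ i, p i = 1) :
    ∃ ρ : ℝ, 0 < ρ ∧ ρ < 1 ∧ ∀ i, p i ≤ ρ := by
  have h1 : ∀ i, p i < 1 := by
    intro i
    obtain ⟨j, hj⟩ : ∃ j : Fin κ, j ≠ i := by
      have : Nontrivial (Fin κ) := Fin.nontrivial_iff_two_le.2 hκ
      exact exists_ne i
    have : p i + p j ≤ ∑ i, p i := by
      rw [← Finset.sum_pair hj.symm]
      exact Finset.sum_le_sum_of_subset_of_nonneg (Finset.subset_univ _) fun i _ _ => (hp i).le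
    have := hp j
    linarith
  have hne : (Finset.univ : Finset (Fin κ)).Nonempty := ⟨⟨0, by omega⟩, Finset.mem_univ _⟩
  obtain ⟨i, -, hi⟩ := Finset.exists_max_image Finset.univ p hne
  exact ⟨p i, hp i, h1 i, fun j => hi j (Finset.mem_univ _)⟩

lemma occ_small (hp : ∀ i, 0 < p i) (hμ : IsBernoulli p μ) {ρ : ℝ} (hρ : ∀ i, p i ≤ ρ)
    (a : ℤ → Fin κ) (ℓ : ℕ) (s : ℤ) : μ.real {x | Occ a ℓ s x} ≤ ρ ^ ℓ := by
  rw [occ_measure hp hμ]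
  calc ∏ i ∈ occF ℓ 0, p (a i) ≤ ∏ i ∈ occF ℓ 0, ρ :=
        Finset.prod_le_prod (fun _ _ => (hp _).le) fun _ _ => hρ _
    _ = ρ ^ ℓ := by rw [Finset.prod_const]; congr 1; simp [occF]

/-- Long absence of a word is unlikely. -/
lemma nonocc_small (hp : ∀ i, 0 < p i) (hμ : IsBernoulli p μ)
    (a : ℤ → Fin κ) (ℓ : ℕ) (hℓ : 1 ≤ ℓ) (δ : ℝ) (hδ : 0 < δ) :
    ∃ J : ℕ, ∀ base : ℤ, μ.real {x | ∀ s : ℕ, s < J → ¬ Occ a ℓ (base + s) x} < δ := by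
  have := hμ.1
  set c := ∏ i ∈ occF ℓ 0, p (a i) with hc
  have hc0 : 0 < c := Finset.prod_pos fun i _ => hp _
  have hc1 : c ≤ 1 := by
    rw [hc, ← occ_measure hp hμ a ℓ 0]; exact measureReal_le_one
  obtain ⟨J, hJ⟩ := exists_pow_lt_of_lt_one hδ (show 1 - c < 1 by linarith)
  refine ⟨J * ℓ, fun base => ?_⟩
  have h1 := nonocc_step hp hμ a ℓ J ∅ a (by simp)
  have h2 : (cyl ∅ a : Set (Sig κ)) = Set.univ := by ext; simp [cyl]
  rw [h2, Set.inter_univ, probReal_univ, mul_one, ← hc] at h1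
  have hsub : {x : Sig κ | ∀ s : ℕ, s < J * ℓ → ¬ Occ a ℓ (base + s) x} ⊆
      sh base ⁻¹' {x | ∀ j < J, ¬ Occ a ℓ (j * ℓ : ℤ) x} := by
    intro x hx j hj ho
    apply hx (j * ℓ) (Nat.mul_lt_mul_of_pos_right hj hℓ)
    intro i h0 h1
    rw [← ho i h0 h1, sh_apply]
    congr 1; push_cast; ring
  have hm : MeasurableSet {x : Sig κ | ∀ j < J, ¬ Occ a ℓ (j * ℓ : ℤ) x} := by
    have : {x : Sig κ | ∀ j < J, ¬ Occ a ℓ (j * ℓ : ℤ) x} =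
        ⋂ j ∈ Finset.range J, {x | Occ a ℓ (j * ℓ : ℤ) x}ᶜ := by
      ext x; simp
    rw [this]
    exact Finset.measurableSet_biInter _ fun j _ => by
      rw [occ_eq]; exact (measurableSet_cyl _ _).compl
  calc _ ≤ μ.real (sh base ⁻¹' {x | ∀ j < J, ¬ Occ a ℓ (j * ℓ : ℤ) x}) := measureReal_mono hsub
    _ = μ.real {x | ∀ j < J, ¬ Occ a ℓ (j * ℓ : ℤ) x} := by
      rw [Measure.real, Measure.real, (sh_preserving hμ base).measure_preimage hm.nullMeasurableSet]
    _ < δ := by rw [h1]; exact hJ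

end bern

/-! ### The block lemma -/

section block
variable {κ : ℕ}

def lg (g : SL2) : ℝ := Real.log ‖toEuc g‖

lemma lg_nonneg (g : SL2) : 0 ≤ lg g := Real.log_nonneg (one_le_norm g)
lemma lg_mul (g h : SL2) : lg (g * h) ≤ lg g + lg h := by
  rw [lg, lg, lg, ← Real.log_mul (npos g).ne' (npos h).ne']
  exact Real.log_le_log (npos _) (nmul_le g h)
lemma lg_inv (g : SL2) : lg g⁻¹ = lg g := by rw [lg, norm_inv_eq, lg]
lemma lg_left (g h : SL2) : lg h ≤ lg (g * h) + lg g := by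
  have := lg_mul g⁻¹ (g * h)
  rw [inv_mul_cancel_left, lg_inv] at this
  linarith
lemma lg_right (g h : SL2) : lg g ≤ lg (g * h) + lg h := by
  have := lg_mul (g * h) h⁻¹
  rw [mul_inv_cancel_right, lg_inv] at this
  linarith
lemma lg_one : lg 1 = 0 := by simp [lg, toEuc_one]

lemma lg_rot (t : ℝ) : lg (rot t) = 0 := by simp [lg, norm_rot]

lemma lg_coc {B : Sig κ → SL2} {C : ℝ} (hC : ∀ x, lg (B x) ≤ C) (n : ℕ) (x : Sig κ) :
    lg (coc shift B n x) ≤ n * C := by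
  induction n generalizing x with
  | zero => simp [coc, lg_one]
  | succ n ih =>
    rw [coc]
    have := lg_mul (coc shift B n (shift x)) (B x)
    have := ih (shift x); have := hC x
    push_cast; linarith

lemma coc_sh_add (B : Sig κ → SL2) (a b : ℕ) (x : Sig κ) :
    coc shift B (a + b) x = coc shift B a (sh b x) * coc shift B b x := by
  rw [coc_add, shift_iter]

lemma lg_swap (g h : SL2) (D : ℝ) (h1 : lg g - lg h ≤ D) (h2 : lg h - lg g ≤ D) :
    ∃ t, |t| ≤ Real.pi ∧ lg (h * (rot t * g)) ≤ Real.log 2 + D := by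
  obtain ⟨t, ht, h3⟩ := swap_lemma g h
  refine ⟨t, ht, ?_⟩
  have a1 : ‖toEuc g‖ / ‖toEuc h‖ ≤ Real.exp D := by
    rw [← Real.log_le_iff_le_exp (div_pos (npos g) (npos h)), Real.log_div (npos g).ne' (npos h).ne']
    exact h1
  have a2 : ‖toEuc h‖ / ‖toEuc g‖ ≤ Real.exp D := by
    rw [← Real.log_le_iff_le_exp (div_pos (npos h) (npos g)), Real.log_div (npos h).ne' (npos g).ne']
    exact h2
  rw [lg, Real.log_le_iff_le_exp (npos _), Real.exp_add, Real.exp_log (by norm_num)]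
  linarith

lemma cprod_add (C : ℕ → SL2) (a b : ℕ) :
    cprod C (a + b) = cprod (fun i => C (i + b)) a * cprod C b := by
  induction a with
  | zero => simp [cprod]
  | succ a ih => rw [add_right_comm, cprod, ih, cprod, mul_assoc]

/-- inserting rotations along the periodic orbit -/
lemma cprod_rot_period (B : Sig κ → SL2) (y : Sig κ) (n : ℕ) (hn : 1 ≤ n) (hy : sh n y = y)
    (h1 : coc shift B n y = 1) (θ : ℝ) (m : ℕ) :
    cprod (fun i => B (sh i y) * rot (if n ∣ i then θ else 0)) (m * n) = rot (m * θ) := by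
  have hfirst : ∀ j, 1 ≤ j → j ≤ n →
      cprod (fun i => B (sh i y) * rot (if n ∣ i then θ else 0)) j
        = cprod (fun i => B (sh i y)) j * rot θ := by
    intro j hj
    induction j, hj using Nat.le_induction with
    | base => intro _; simp [cprod]
    | succ j hj ih =>
      intro hjn
      have hnd : ¬ n ∣ j := fun h => by have := Nat.le_of_dvd (by omega) h; omega
      rw [cprod, ih (by omega), cprod, if_neg hnd, rot_zero, mul_one, mul_assoc]
  have hn' : cprod (fun i => B (sh i y) * rot (if n ∣ i then θ else 0)) n = rot θ := by
    rw [hfirst n hn le_rfl, ← coc_eq_cprod, h1, one_mul]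
  induction m with
  | zero => simp [cprod, rot_zero]
  | succ m ih =>
    rw [add_mul, one_mul, cprod_add, hn']
    have : cprod (fun i => B (sh (↑(i + n)) y) * rot (if n ∣ i + n then θ else 0)) (m * n) =
        cprod (fun i => B (sh i y) * rot (if n ∣ i then θ else 0)) (m * n) := by
      apply cprod_congr
      intro i _
      have e1 : sh ((i + n : ℕ) : ℤ) y = sh i y := by
        push_cast; rw [← sh_sh, hy]
      rw [e1]
      simp
    rw [this, ih, ← rot_add]
    congr 1; push_cast; ring

/-- the resonant block occurs at time zero -/
def Vocc (y : Sig κ) (k L : ℕ) (x : Sig κ) : Prop := ∀ i : ℤ, -k ≤ i → i < L + k → x i = y i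

/-- no resonant block in the next `W` steps -/
def Bad (y : Sig κ) (k L W : ℕ) (x : Sig κ) : Prop := ∀ s : ℕ, s < W → ¬ Vocc y k L (sh s x)

open Classical in
lemma bad_count (y : Sig κ) (k L W : ℕ) (z : Sig κ) (t0 T R : ℕ) (hTR : T ≤ R)
    (h : ∀ t, t0 ≤ t → t < T → ¬ Vocc y k L (sh t z)) :
    T ≤ t0 + W + ((Finset.range R).filter (fun s : ℕ => Bad y k L W (sh (s : ℤ) z))).card := by
  have hsub : Finset.Ico t0 (T - W) ⊆ (Finset.range R).filter (fun s : ℕ => Bad y k L W (sh (s : ℤ) z)) := by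
    intro s hs
    rw [Finset.mem_Ico] at hs
    rw [Finset.mem_filter, Finset.mem_range]
    refine ⟨by omega, ?_⟩
    intro r hr
    rw [sh_sh]
    have := h (r + s) (by omega) (by omega)
    push_cast at this
    exact this
  have := Finset.card_le_card hsub
  rw [Nat.card_Ico] at this
  omega

lemma balanced (B : Sig κ → SL2) {C : ℝ} (hC0 : 0 ≤ C) (hC : ∀ x, lg (B x) ≤ C) (z : Sig κ) (R : ℕ) :
    ∃ t ≤ R, lg (coc shift B (R - t) (sh t z)) ≤ lg (coc shift B t z) ∧
      lg (coc shift B t z) ≤ lg (coc shift B (R - t) (sh t z)) + 2 * C := by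
  classical
  have hex : ∃ t, t ≤ R ∧ lg (coc shift B (R - t) (sh t z)) ≤ lg (coc shift B t z) :=
    ⟨R, le_rfl, by simp [coc, lg_one, lg_nonneg]⟩
  obtain ⟨h1, h2⟩ := Nat.find_spec hex
  refine ⟨Nat.find hex, h1, h2, ?_⟩
  rcases hs : Nat.find hex with _ | s
  · have := lg_nonneg (coc shift B (R - 0) (sh ((0 : ℕ) : ℤ) z))
    simp only [coc, lg_one]
    linarith
  · have hlt : s < Nat.find hex := by omega
    have h3 := Nat.find_min hex hlt
    have hsR : s + 1 ≤ R := by omega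
    have h4 : lg (coc shift B s z) < lg (coc shift B (R - s) (sh s z)) := by
      by_contra! h
      exact h3 ⟨by omega, h⟩
    have e1 : coc shift B (s + 1) z = B (sh s z) * coc shift B s z := by rw [coc_succ', shift_iter]
    have e2 : coc shift B (R - s) (sh s z) = coc shift B (R - (s + 1)) (sh (s + 1 : ℕ) z) * B (sh s z) := by
      have : R - s = (R - (s + 1)) + 1 := by omega
      rw [this, coc, shift_eq_sh, sh_sh]
      congr 3; push_cast; ring
    rw [e1]
    have := lg_mul (B (sh s z)) (coc shift B s z)
    have := lg_mul (coc shift B (R - (s + 1)) (sh (s + 1 : ℕ) z)) (B (sh s z))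
    rw [e2] at h4
    have := hC (sh s z)
    linarith

open Classical in
lemma block_lemma (B : Sig κ → SL2) (k : ℕ) (hB : Win k B) (y : Sig κ) (n m : ℕ) (hn : 1 ≤ n)
    (hm : 1 ≤ m) (hy : sh n y = y) (h1 : coc shift B n y = 1) {C : ℝ} (hC0 : 0 ≤ C)
    (hC : ∀ x, lg (B x) ≤ C) (W : ℕ) (z : Sig κ) (R : ℕ) :
    ∃ Θ : ℕ → ℝ, (∀ i, |Θ i| ≤ Real.pi / m) ∧
      lg (cprod (fun i => B (sh i z) * rot (Θ i)) R) ≤ (Real.log 2 + 2 * C + 2 * C * (m * n : ℕ) + 2 * C * W)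
        + 2 * C * ((Finset.range R).filter (fun s : ℕ => Bad y k (m * n) W (sh (s : ℤ) z))).card := by
  have hlog2 : 0 ≤ Real.log 2 := Real.log_nonneg (by norm_num)
  have hmn : 1 ≤ m * n := Nat.mul_pos hm hn
  have hm0 : (0 : ℝ) < m := by exact_mod_cast hm
  set N := ((Finset.range R).filter (fun s : ℕ => Bad y k (m * n) W (sh (s : ℤ) z))).card with hN
  obtain ⟨t0, ht0R, hb1, hb2⟩ := balanced B hC0 hC z R
  by_cases hex : ∃ t, t0 ≤ t ∧ t + m * n ≤ R ∧ Vocc y k (m * n) (sh t z)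
  · obtain ⟨ht1, ht1R, hV⟩ := Nat.find_spec hex
    have hmin : ∀ t, t0 ≤ t → t < Nat.find hex → ¬ Vocc y k (m * n) (sh t z) := by
      intro t h2 h3 h4
      exact Nat.find_min hex h3 ⟨h2, by omega, h4⟩
    set t1 := Nat.find hex with ht1def
    clear_value t1
    have hcount := bad_count y k (m * n) W z t0 t1 R (by omega) hmin
    rw [← hN] at hcount
    -- pieces
    obtain ⟨u, rfl⟩ := Nat.exists_eq_add_of_le' ht1
    obtain ⟨v, hv⟩ := Nat.exists_eq_add_of_le' ht1R
    set g := coc shift B (u + t0) z with hg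
    set h := coc shift B v (sh ((u + t0 + m * n : ℕ) : ℤ) z) with hh
    have p1 : g = coc shift B u (sh t0 z) * coc shift B t0 z := coc_sh_add _ _ _ _
    have p2 : coc shift B (R - t0) (sh t0 z) = h * coc shift B (u + m * n) (sh t0 z) := by
      have : R - t0 = v + (u + m * n) := by omega
      rw [this, coc_sh_add, hh, sh_sh]
      congr 3; push_cast; ring
    have q1 := lg_coc hC u (sh t0 z)
    have q2 := lg_coc hC (u + m * n) (sh t0 z)
    have r1 := lg_mul (coc shift B u (sh t0 z)) (coc shift B t0 z)
    have r2 := lg_left (coc shift B u (sh t0 z)) (coc shift B t0 z)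
    have r3 := lg_mul h (coc shift B (u + m * n) (sh t0 z))
    have r4 := lg_right h (coc shift B (u + m * n) (sh t0 z))
    rw [← p1] at r1 r2
    rw [← p2] at r3 r4
    push_cast at q2
    obtain ⟨ψ, hψ, hlg⟩ := lg_swap g h (2 * C + 2 * C * u + C * (m * n : ℕ))
      (by push_cast; linarith) (by push_cast; linarith)
    refine ⟨fun i => if u + t0 ≤ i ∧ i < u + t0 + m * n ∧ n ∣ (i - (u + t0)) then ψ / m else 0, ?_, ?_⟩
    · intro i
      simp only
      split_ifs
      · rw [abs_div, abs_of_pos hm0]; gcongr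
      · simp; positivity
    · have hR : R = v + (m * n + (u + t0)) := by omega
      have s1 : cprod (fun i => B (sh i z) * rot (if u + t0 ≤ i ∧ i < u + t0 + m * n ∧ n ∣ (i - (u + t0)) then ψ / m else 0)) R
          = h * (rot ψ * g) := by
        rw [hR, cprod_add, cprod_add]
        congr 1
        · rw [hh, coc_eq_cprod]
          apply cprod_congr
          intro j _
          rw [if_neg (by omega), rot_zero, mul_one, sh_sh]
          congr 2; push_cast; ring
        · congr 1
          · have := cprod_rot_period B y n hn hy h1 (ψ / m) m
            rw [mul_div_cancel₀ _ hm0.ne'] at this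
            rw [← this]
            apply cprod_congr
            intro j hj
            have e1 : B (sh ((j + (u + t0) : ℕ) : ℤ) z) = B (sh j y) := by
              apply hB
              intro i hi
              rw [abs_le] at hi
              have := hV (i + j) (by omega) (by push_cast; push_cast at hj; have : (j : ℤ) < (m : ℤ) * n := by exact_mod_cast hj
                                                omega)
              simp only [sh_apply] at this ⊢
              rw [← this]; congr 1; push_cast; ring
            rw [e1]
            congr 2
            have : j + (u + t0) - (u + t0) = j := by omega
            rw [this]
            by_cases hd : n ∣ j
            · rw [if_pos ⟨by omega, by omega, hd⟩, if_pos hd]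
            · rw [if_neg (fun h => hd h.2.2), if_neg hd]
          · rw [hg, coc_eq_cprod]
            apply cprod_congr
            intro j hj
            rw [if_neg (by omega), rot_zero, mul_one]
      rw [s1]
      refine hlg.trans ?_
      have hu : (u : ℝ) ≤ W + N := by
        have : u ≤ W + N := by omega
        exact_mod_cast this
      have : 0 ≤ C * (m * n : ℕ) := by positivity
      nlinarith
  · push Not at hex
    refine ⟨fun _ => 0, fun i => by simp; positivity, ?_⟩
    simp only [rot_zero, mul_one]
    rw [← coc_eq_cprod]
    have hcount := bad_count y k (m * n) W z t0 (R + 1 - m * n) R (by omega)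
      (fun t h2 h3 => hex t h2 (by omega))
    rw [← hN] at hcount
    have e1 : coc shift B R z = coc shift B (R - t0) (sh t0 z) * coc shift B t0 z := by
      rw [← coc_sh_add]; congr 1; omega
    have r1 := lg_mul (coc shift B (R - t0) (sh t0 z)) (coc shift B t0 z)
    have q1 := lg_coc hC (R - t0) (sh t0 z)
    rw [e1]
    have hu : ((R - t0 : ℕ) : ℝ) ≤ (m * n : ℕ) + W + N := by
      have : R - t0 ≤ m * n + W + N := by omega
      exact_mod_cast this
    nlinarith

end block

/-! ### The reduction step: combinatorics of marker blocks -/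

section red
variable {κ : ℕ}

/-- `x` lies in a marker block, `i` steps after the last visit, `r` steps before the next one,
of length at most `Rm` -/
def Blk (V : Sig κ → Prop) (Rm : ℕ) (x : Sig κ) (q : ℕ × ℕ) : Prop :=
  V (sh (-(q.1 : ℤ)) x) ∧ V (sh (q.2 : ℤ) x) ∧ 1 ≤ q.2 ∧
    (∀ s : ℤ, -(q.1 : ℤ) < s → s < q.2 → ¬ V (sh s x)) ∧ q.1 + q.2 ≤ Rm

def Short (V : Sig κ → Prop) (Rm : ℕ) (x : Sig κ) : Prop := ∃ q, Blk V Rm x q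

lemma blk_unique {V : Sig κ → Prop} {Rm : ℕ} {x : Sig κ} {q q' : ℕ × ℕ}
    (h : Blk V Rm x q) (h' : Blk V Rm x q') : q = q' := by
  obtain ⟨a1, a2, a3, a4, a5⟩ := h
  obtain ⟨b1, b2, b3, b4, b5⟩ := h'
  have c1 := fun h1 h2 => a4 _ h1 h2 b1
  have c2 := fun h1 h2 => a4 _ h1 h2 b2
  have c3 := fun h1 h2 => b4 _ h1 h2 a1
  have c4 := fun h1 h2 => b4 _ h1 h2 a2
  ext
  · by_contra hne
    rcases lt_or_gt_of_ne hne with h | h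
    · exact c3 (by omega) (by omega)
    · exact c1 (by omega) (by omega)
  · by_contra hne
    rcases lt_or_gt_of_ne hne with h | h
    · exact c4 (by omega) (by omega)
    · exact c2 (by omega) (by omega)

lemma not_short {V : Sig κ → Prop} {Rm : ℕ} {x : Sig κ} {t : ℕ} (ht : Rm < t)
    (h : ∀ s : ℕ, 0 < s → s < t → ¬ V (sh s x)) (s : ℕ) (hs : s < t) : ¬ Short V Rm (sh s x) := by
  rintro ⟨⟨i, r⟩, h1, h2, h3, h4, h5⟩
  simp only at h1 h2 h3 h4 h5
  rw [sh_sh] at h1 h2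
  have e1 : s ≤ i := by
    by_contra! hlt
    refine h (s - i) (by omega) (by omega) ?_
    convert h1 using 2
    omega
  have e2 : t ≤ s + r := by
    by_contra! hlt
    refine h (s + r) (by omega) (by omega) ?_
    convert h2 using 2
    omega
  omega

lemma coc_le_sum {B : Sig κ → SL2} {C : ℝ} (hC : ∀ x, lg (B x) ≤ C) (g : Sig κ → ℝ)
    {V : Sig κ → Prop} {Rm : ℕ} (hlong : ∀ x, ¬ Short V Rm x → C ≤ g x) {x : Sig κ} {t : ℕ}
    (ht : Rm < t) (h : ∀ s : ℕ, 0 < s → s < t → ¬ V (sh s x)) :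
    lg (coc shift B t x) ≤ ∑ s ∈ Finset.range t, g (sh s x) := by
  refine (lg_coc hC t x).trans ?_
  have : (t : ℝ) * C = ∑ s ∈ Finset.range t, C := by simp
  rw [this]
  exact Finset.sum_le_sum fun s hs => hlong _ (not_short ht h s (Finset.mem_range.1 hs))

lemma sum_split (g : Sig κ → ℝ) (r M : ℕ) (hr : r ≤ M) (x : Sig κ) :
    ∑ s ∈ Finset.range M, g (sh s x) =
      ∑ s ∈ Finset.range r, g (sh s x) + ∑ s ∈ Finset.range (M - r), g (sh s (sh r x)) := by
  obtain ⟨d, rfl⟩ := Nat.exists_eq_add_of_le hr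
  rw [Finset.sum_range_add]
  congr 1
  have : r + d - r = d := by omega
  rw [this]
  refine Finset.sum_congr rfl fun s _ => ?_
  rw [sh_sh]; congr 2; push_cast; ring

/-- estimate starting from a visit -/
lemma est_visit {B : Sig κ → SL2} {C : ℝ} (hC0 : 0 ≤ C) (hC : ∀ x, lg (B x) ≤ C) (g : Sig κ → ℝ)
    (hg : ∀ x, 0 ≤ g x) {V : Sig κ → Prop} {Rm : ℕ} (hlong : ∀ x, ¬ Short V Rm x → C ≤ g x)
    (hblk : ∀ z R, 1 ≤ R → R ≤ Rm → V z → V (sh (R : ℕ) z) →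
      (∀ s : ℕ, 0 < s → s < R → ¬ V (sh s z)) →
      lg (coc shift B R z) ≤ ∑ s ∈ Finset.range R, g (sh s z)) (M : ℕ) :
    ∀ z, V z → lg (coc shift B M z) ≤ ∑ s ∈ Finset.range M, g (sh s z) + C * Rm := by
  classical
  have hCR : 0 ≤ C * Rm := by positivity
  induction M using Nat.strong_induction_on with
  | _ M ih =>
  intro z hz
  by_cases hex : ∃ r : ℕ, 0 < r ∧ r < M ∧ V (sh r z)
  · obtain ⟨h1, h2, h3⟩ := Nat.find_spec hex
    have hmin : ∀ s : ℕ, 0 < s → s < Nat.find hex → ¬ V (sh s z) := fun s a1 a2 a3 =>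
      Nat.find_min hex a2 ⟨a1, by omega, a3⟩
    generalize Nat.find hex = r at *
    have hb : lg (coc shift B r z) ≤ ∑ s ∈ Finset.range r, g (sh s z) := by
      rcases le_or_gt r Rm with hr | hr
      · exact hblk z r h1 hr hz h3 hmin
      · exact coc_le_sum hC g hlong hr hmin
    have hi := ih (M - r) (by omega) (sh r z) h3
    have e : coc shift B M z = coc shift B (M - r) (sh r z) * coc shift B r z := by
      rw [← coc_sh_add]; congr 1; omega
    rw [e, sum_split g r M h2.le]
    have := lg_mul (coc shift B (M - r) (sh r z)) (coc shift B r z)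
    linarith
  · push Not at hex
    have hs : 0 ≤ ∑ s ∈ Finset.range M, g (sh s z) := Finset.sum_nonneg fun s _ => hg _
    rcases le_or_gt M Rm with hr | hr
    · have := lg_coc hC M z
      have h2 : (M : ℝ) * C ≤ C * Rm := by
        rw [mul_comm]; gcongr
      linarith
    · have := coc_le_sum hC g hlong hr hex
      linarith

lemma est_all {B : Sig κ → SL2} {C : ℝ} (hC0 : 0 ≤ C) (hC : ∀ x, lg (B x) ≤ C) (g : Sig κ → ℝ)
    (hg : ∀ x, 0 ≤ g x) {V : Sig κ → Prop} {Rm : ℕ} (hlong : ∀ x, ¬ Short V Rm x → C ≤ g x)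
    (hblk : ∀ z R, 1 ≤ R → R ≤ Rm → V z → V (sh (R : ℕ) z) →
      (∀ s : ℕ, 0 < s → s < R → ¬ V (sh s z)) →
      lg (coc shift B R z) ≤ ∑ s ∈ Finset.range R, g (sh s z)) (M : ℕ) (z : Sig κ) :
    lg (coc shift B M z) ≤ ∑ s ∈ Finset.range M, g (sh s z) + 2 * (C * Rm) := by
  classical
  have hCR : 0 ≤ C * Rm := by positivity
  have short_bd : ∀ r : ℕ, r ≤ Rm → lg (coc shift B r z) ≤ C * Rm := by
    intro r hr
    refine (lg_coc hC r z).trans ?_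
    rw [mul_comm]; gcongr
  by_cases hex : ∃ r : ℕ, 0 < r ∧ r < M ∧ V (sh r z)
  · obtain ⟨h1, h2, h3⟩ := Nat.find_spec hex
    have hmin : ∀ s : ℕ, 0 < s → s < Nat.find hex → ¬ V (sh s z) := fun s a1 a2 a3 =>
      Nat.find_min hex a2 ⟨a1, by omega, a3⟩
    generalize Nat.find hex = r at *
    have hs : 0 ≤ ∑ s ∈ Finset.range r, g (sh s z) := Finset.sum_nonneg fun s _ => hg _
    have hb : lg (coc shift B r z) ≤ ∑ s ∈ Finset.range r, g (sh s z) + C * Rm := by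
      rcases le_or_gt r Rm with hr | hr
      · have := short_bd r hr
        linarith
      · have := coc_le_sum hC g hlong hr hmin
        linarith
    have hi := est_visit hC0 hC g hg hlong hblk (M - r) (sh r z) h3
    have e : coc shift B M z = coc shift B (M - r) (sh r z) * coc shift B r z := by
      rw [← coc_sh_add]; congr 1; omega
    rw [e, sum_split g r M h2.le]
    have := lg_mul (coc shift B (M - r) (sh r z)) (coc shift B r z)
    linarith
  · push Not at hex
    have hs : 0 ≤ ∑ s ∈ Finset.range M, g (sh s z) := Finset.sum_nonneg fun s _ => hg _
    rcases le_or_gt M Rm with hr | hr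
    · have := short_bd M hr
      linarith
    · have := coc_le_sum hC g hlong hr hex
      linarith

/-! windows -/

lemma agree_sh {k K : ℕ} {x x' : Sig κ} (h : Agree K x x') (j : ℤ) (hj : |j| + k ≤ K) :
    Agree k (sh j x) (sh j x') := by
  intro i hi
  rw [sh_apply, sh_apply]
  exact h _ ((abs_add_le _ _).trans (by linarith))

lemma win_blk {V : Sig κ → Prop} {l : ℕ} (hV : Win l V) (Rm : ℕ) (q : ℕ × ℕ) {x x' : Sig κ}
    (h : Agree (Rm + l) x x') (hq : Blk V Rm x q) : Blk V Rm x' q := by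
  obtain ⟨h1, h2, h3, h4, h5⟩ := hq
  have key : ∀ s : ℤ, -(q.1 : ℤ) ≤ s → s ≤ q.2 → V (sh s x) = V (sh s x') := by
    intro s a b
    apply hV
    apply agree_sh h
    push_cast
    have : |s| ≤ Rm := by rw [abs_le]; omega
    linarith
  refine ⟨?_, ?_, h3, ?_, h5⟩
  · rw [← key _ le_rfl (by omega)]; exact h1
  · rw [← key _ (by omega) le_rfl]; exact h2
  · intro s a b
    rw [← key _ a.le b.le]; exact h4 s a b

lemma win_short {V : Sig κ → Prop} {l : ℕ} (hV : Win l V) (Rm : ℕ) : Win (Rm + l) (Short V Rm) := by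
  intro x x' h
  exact propext ⟨fun ⟨q, hq⟩ => ⟨q, win_blk hV Rm q h hq⟩, fun ⟨q, hq⟩ => ⟨q, win_blk hV Rm q h.symm hq⟩⟩

lemma win_bad (y : Sig κ) (k L W : ℕ) : Win (W + L + k) (Bad y k L W) := by
  have key : ∀ x x', Agree (W + L + k) x x' → Bad y k L W x → Bad y k L W x' := by
    intro x x' h hb s hs hv
    refine hb s hs ?_
    intro i h1 h2
    rw [← hv i h1 h2, sh_apply, sh_apply]
    apply h
    rw [abs_le]; push_cast; omega
  exact fun x x' h => propext ⟨key x x' h, key x' x h.symm⟩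

lemma win_occ (a : ℤ → Fin κ) (ℓ : ℕ) : Win ℓ (Occ a ℓ 0) := by
  have key : ∀ x x', Agree ℓ x x' → Occ a ℓ 0 x → Occ a ℓ 0 x' := by
    intro x x' h hb i h1 h2
    rw [← hb i h1 h2]
    exact (h _ (by rw [abs_le]; omega)).symm
  exact fun x x' h => propext ⟨key x x' h, key x' x h.symm⟩

lemma occ_sh (a : ℤ → Fin κ) (ℓ : ℕ) (s : ℤ) (x : Sig κ) : Occ a ℓ 0 (sh s x) ↔ Occ a ℓ s x := by
  unfold Occ
  refine forall_congr' fun i => ?_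
  rw [sh_apply, zero_add, add_comm i s]

open Classical in
/-- the perturbation angle -/
def ang (V : Sig κ → Prop) (Rm : ℕ) (Φ : Sig κ → ℕ → ℕ → ℝ) (x : Sig κ) : ℝ :=
  if h : ∃ q, Blk V Rm x q then
    Φ (sh (-(h.choose.1 : ℤ)) x) (h.choose.1 + h.choose.2) h.choose.1 else 0

lemma ang_eq {V : Sig κ → Prop} {Rm : ℕ} (Φ : Sig κ → ℕ → ℕ → ℝ) {x : Sig κ} {q : ℕ × ℕ}
    (h : Blk V Rm x q) : ang V Rm Φ x = Φ (sh (-(q.1 : ℤ)) x) (q.1 + q.2) q.1 := by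
  have hex : ∃ q, Blk V Rm x q := ⟨q, h⟩
  rw [ang, dif_pos hex, blk_unique hex.choose_spec h]

lemma ang_eq_zero {V : Sig κ → Prop} {Rm : ℕ} (Φ : Sig κ → ℕ → ℕ → ℝ) {x : Sig κ}
    (h : ¬ Short V Rm x) : ang V Rm Φ x = 0 := by
  unfold Short at h; rw [ang, dif_neg h]

lemma win_ang {V : Sig κ → Prop} {l : ℕ} (hV : Win l V) (Rm : ℕ) (Φ : Sig κ → ℕ → ℕ → ℝ) (K : ℕ)
    (hΦ : Win K Φ) : Win (Rm + (l + K)) (ang V Rm Φ) := by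
  intro x x' h
  by_cases hs : Short V Rm x
  · obtain ⟨q, hq⟩ := hs
    have hq' := win_blk hV Rm q (h.mono (by omega)) hq
    rw [ang_eq Φ hq, ang_eq Φ hq']
    have : Φ (sh (-(q.1 : ℤ)) x) = Φ (sh (-(q.1 : ℤ)) x') := by
      apply hΦ
      apply agree_sh h
      have := hq.2.2.2.2
      rw [abs_neg, abs_of_nonneg (by omega)]
      push_cast; omega
    rw [this]
  · have hs' : ¬ Short V Rm x' := by rwa [← win_short hV Rm x x' (h.mono (by omega))]
    rw [ang_eq_zero Φ hs, ang_eq_zero Φ hs']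

lemma coc_block {V : Sig κ → Prop} {Rm : ℕ} (Φ : Sig κ → ℕ → ℕ → ℝ) (B : Sig κ → SL2) (z : Sig κ) (R : ℕ)
    (hR : R ≤ Rm) (h1 : V z) (h2 : V (sh (R : ℕ) z))
    (h3 : ∀ s : ℕ, 0 < s → s < R → ¬ V (sh s z)) :
    coc shift (fun x => B x * rot (ang V Rm Φ x)) R z =
      cprod (fun i => B (sh i z) * rot (Φ z R i)) R := by
  rw [coc_eq_cprod]
  apply cprod_congr
  intro i hi
  have hq : Blk V Rm (sh i z) (i, R - i) := by
    refine ⟨?_, ?_, by simp only; omega, ?_, by simp only; omega⟩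
    · simp only [sh_sh, neg_add_cancel, sh_zero]; exact h1
    · simp only [sh_sh]
      have : ((R - i : ℕ) : ℤ) + i = (R : ℕ) := by omega
      rw [this]; exact h2
    · intro s a b
      simp only at a b
      rw [sh_sh]
      have : s + i = ((s + i).toNat : ℕ) := by omega
      rw [this]
      exact h3 _ (by omega) (by omega)
  rw [ang_eq Φ hq]
  simp only [sh_sh, neg_add_cancel, sh_zero]
  congr 3
  omega

end red

/-! ### The reduction step -/

section red2
variable {κ : ℕ}

open Classical in
def ind (P : Sig κ → Prop) (x : Sig κ) : ℝ := if P x then 1 else 0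

lemma ind_nonneg (P : Sig κ → Prop) (x : Sig κ) : 0 ≤ ind P x := by
  unfold ind; split_ifs <;> norm_num

lemma ind_pos {P : Sig κ → Prop} {x : Sig κ} (h : P x) : ind P x = 1 := by simp [ind, h]

lemma win_ind {P : Sig κ → Prop} {k : ℕ} (h : Win k P) : Win k (ind P) := by
  intro x x' hx
  have e : P x = P x' := h x x' hx
  unfold ind
  by_cases h' : P x'
  · rw [if_pos h', if_pos (e ▸ h')]
  · rw [if_neg h', if_neg (e ▸ h')]

lemma cont_integrable {μ : Measure (Sig κ)} [IsProbabilityMeasure μ] {f : Sig κ → ℝ}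
    (hf : Continuous f) : Integrable f μ :=
  hf.integrable_of_hasCompactSupport (HasCompactSupport.of_compactSpace f)

lemma integral_ind {μ : Measure (Sig κ)} [IsProbabilityMeasure μ] {P : Sig κ → Prop} {k : ℕ}
    (h : Win k P) : ∫ x, ind P x ∂μ = μ.real {x | P x} := by
  have hm : MeasurableSet {x | P x} := by
    have : {x | P x} = ind P ⁻¹' {1} := by
      ext x; by_cases hx : P x <;> simp [ind, hx]
    rw [this]
    exact (win_ind h).continuous.measurable (measurableSet_singleton _)
  rw [← integral_indicator_one hm]
  refine integral_congr_ae (Filter.Eventually.of_forall fun x => ?_)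
  by_cases hx : P x <;> simp [ind, hx, Set.indicator]

lemma ind_sum (P : Sig κ → Prop) [DecidablePred P] (R : ℕ) (z : Sig κ) :
    (((Finset.range R).filter (fun s : ℕ => P (sh (s : ℤ) z))).card : ℝ) =
      ∑ s ∈ Finset.range R, ind P (sh s z) := by
  rw [Finset.card_filter]
  push_cast
  refine Finset.sum_congr rfl fun s _ => ?_
  unfold ind
  split_ifs <;> rfl

variable {p : Fin κ → ℝ} {μ : Measure (Sig κ)}

/-- any fixed word recurs soon with high probability -/
lemma bad_small (hp : ∀ i, 0 < p i) (hμ : IsBernoulli p μ) (y : Sig κ) (k L : ℕ) (hL : 1 ≤ L)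
    (δ : ℝ) (hδ : 0 < δ) : ∃ W, μ.real {x | Bad y k L W x} < δ := by
  have := hμ.1
  obtain ⟨J, hJ⟩ := nonocc_small hp hμ (fun i => y (i - k)) (L + 2 * k) (by omega) δ hδ
  refine ⟨J, lt_of_le_of_lt (measureReal_mono ?_) (hJ (-k))⟩
  intro x hx s hs ho
  refine hx s hs ?_
  intro i h1 h2
  have := ho (i + k) (by omega) (by push_cast; omega)
  simp only [add_sub_cancel_right] at this
  rw [sh_apply, ← this]
  congr 1; ring

lemma long_small (hp : ∀ i, 0 < p i) (hμ : IsBernoulli p μ) (b : Sig κ) (ℓ : ℕ) (hℓ : 1 ≤ ℓ)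
    (δ : ℝ) (hδ : 0 < δ) : ∃ Rm, μ.real {x | ¬ Short (Occ b ℓ 0) Rm x} < δ := by
  classical
  have := hμ.1
  obtain ⟨J, hJ⟩ := nonocc_small hp hμ b ℓ hℓ (δ / 2) (by positivity)
  refine ⟨2 * J, ?_⟩
  have hsub : {x | ¬ Short (Occ b ℓ 0) (2 * J) x} ⊆
      {x | ∀ s : ℕ, s < J → ¬ Occ b ℓ ((1 - J : ℤ) + s) x} ∪
      {x | ∀ s : ℕ, s < J → ¬ Occ b ℓ (1 + s) x} := by
    intro x hx
    by_contra hcon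
    rw [Set.mem_union, not_or] at hcon
    obtain ⟨hc1, hc2⟩ := hcon
    simp only [Set.mem_ofPred_eq, not_forall, not_not] at hc1 hc2
    obtain ⟨s1, hs1, ho1⟩ := hc1
    obtain ⟨s2, hs2, ho2⟩ := hc2
    have he1 : ∃ i : ℕ, Occ b ℓ (-(i : ℤ)) x := ⟨J - 1 - s1, by convert ho1 using 1; omega⟩
    have he2 : ∃ r : ℕ, Occ b ℓ (1 + (r : ℤ)) x := ⟨s2, ho2⟩
    have hl1 : Nat.find he1 ≤ J - 1 - s1 := Nat.find_min' he1 (by convert ho1 using 1; omega)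
    have hl2 : Nat.find he2 ≤ s2 := Nat.find_min' he2 ho2
    refine hx ⟨(Nat.find he1, 1 + Nat.find he2), ?_, ?_, ?_, ?_, ?_⟩
    · rw [occ_sh]; exact Nat.find_spec he1
    · rw [occ_sh]; push_cast; exact Nat.find_spec he2
    · simp only; omega
    · intro s a c ho
      simp only at a c
      rw [occ_sh] at ho
      rcases le_or_gt s 0 with hs | hs
      · refine Nat.find_min he1 (m := (-s).toNat) (by omega) ?_
        convert ho using 1; omega
      · refine Nat.find_min he2 (m := (s - 1).toNat) (by omega) ?_
        convert ho using 1; omega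
    · simp only; omega
  calc _ ≤ _ := measureReal_mono hsub
    _ ≤ _ := measureReal_union_le _ _
    _ < δ := by
      have h1 := hJ (1 - J)
      have h2 := hJ 1
      linarith

theorem reduction (hκ : 2 ≤ κ) (hp : ∀ i, 0 < p i) (hp1 : ∑ i, p i = 1) (hμ : IsBernoulli p μ)
    (B : Sig κ → SL2) (k : ℕ) (hB : Win k B) (y : Sig κ) (n : ℕ) (hn : 1 ≤ n) (hy : sh n y = y)
    (h1 : coc shift B n y = 1) (ε η : ℝ) (hε : 0 < ε) (hη : 0 < η) :
    ∃ (B' : Sig κ → SL2) (k' : ℕ), Win k' B' ∧ (∀ x, ‖toEuc (B x) - toEuc (B' x)‖ < ε) ∧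
      coc shift B' n y = 1 ∧ ∃ M : ℕ, 1 ≤ M ∧ (M : ℝ)⁻¹ * ∫ x, lg (coc shift B' M x) ∂μ < η := by
  classical
  have := hμ.1
  obtain ⟨K, hK1, hK⟩ := exists_bound B hB.continuous
  have hK0 : 0 < K := by linarith
  set C := Real.log K with hCdef
  have hC0 : 0 ≤ C := Real.log_nonneg hK1
  have hC : ∀ x, lg (B x) ≤ C := fun x => Real.log_le_log (npos _) (hK x)
  obtain ⟨r0, hr0, hrot⟩ := exists_rot_small (ε := ε / K) (by positivity)
  obtain ⟨m, hm⟩ := exists_nat_gt (Real.pi / r0)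
  have hm0 : (0 : ℝ) < m := lt_of_le_of_lt (by positivity) hm
  have hm1 : 1 ≤ m := by exact_mod_cast hm0
  have hmr : Real.pi / m ≤ r0 := by
    rw [div_lt_iff₀ hr0] at hm
    rw [div_le_iff₀ hm0]; linarith
  have hmn : 1 ≤ m * n := Nat.mul_pos hm1 hn
  -- W
  obtain ⟨W, hW⟩ := bad_small hp hμ y k (m * n) hmn (η / (4 * (2 * C + 1))) (by positivity)
  set c1 := Real.log 2 + 2 * C + 2 * C * (m * n : ℕ) + 2 * C * W with hc1
  have hc10 : 0 ≤ c1 := by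
    have : 0 ≤ Real.log 2 := Real.log_nonneg (by norm_num)
    positivity
  -- marker word
  obtain ⟨ρ, hρ0, hρ1, hρ⟩ := exists_rho hκ hp hp1
  obtain ⟨ℓ0, hℓ0⟩ := exists_pow_lt_of_lt_one (show 0 < η / (4 * (c1 + 1)) by positivity) hρ1
  set ℓ := ℓ0 + n with hℓ
  have hb : ∀ i : ℤ, ∃ a : Fin κ, a ≠ y (2 * i) := by
    intro i
    have : Nontrivial (Fin κ) := Fin.nontrivial_iff_two_le.2 hκ
    exact exists_ne _
  choose b hb using hb
  set V : Sig κ → Prop := Occ b ℓ 0 with hV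
  have hVw : Win ℓ V := win_occ b ℓ
  have hVm : μ.real {x | V x} < η / (4 * (c1 + 1)) := by
    refine (occ_small hp hμ hρ b ℓ 0).trans_lt (lt_of_le_of_lt ?_ hℓ0)
    exact pow_le_pow_of_le_one hρ0.le hρ1.le (by omega)
  have hVy : ∀ j : ℤ, ¬ V (sh j y) := by
    intro j hj
    have hn0 : (0 : ℤ) < n := by exact_mod_cast hn
    have h2 := hj (j % n) (Int.emod_nonneg _ hn0.ne') (by
      have := Int.emod_lt_of_pos j hn0
      push_cast [hℓ]; omega)
    have h3 : Function.Periodic y (n : ℤ) := fun i => by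
      have := congrFun hy i; exact this
    refine hb (j % n) ?_
    rw [← h2, sh_apply]
    have e : 0 + j % n + j = 2 * (j % n) + (j / n) * n := by
      have := Int.emod_add_mul_ediv j n
      linarith
    rw [e]
    exact (h3.int_mul (j / n)) _
  obtain ⟨Rm, hRm⟩ := long_small hp hμ b ℓ (by omega) (η / (4 * (C + 1))) (by positivity)
  obtain ⟨M, hM⟩ := exists_nat_gt (max 1 (2 * (C * Rm) / (η / 4)))
  have hM1 : 1 ≤ M := by
    have : (1 : ℝ) < M := lt_of_le_of_lt (le_max_left _ _) hM
    exact_mod_cast this.le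
  have hMpos : (0 : ℝ) < M := by exact_mod_cast hM1
  have hM2 : 2 * (C * Rm) < η / 4 * M := by
    have : 2 * (C * Rm) / (η / 4) < M := lt_of_le_of_lt (le_max_right _ _) hM
    rwa [div_lt_iff₀' (by positivity)] at this
  -- angles
  have hΘ := fun z R => block_lemma B k hB y n m hn hm1 hy h1 hC0 hC W z R
  choose Θ hΘ1 hΘ2 using hΘ
  set kk := Rm + (W + m * n + k) with hkk
  set Φ : Sig κ → ℕ → ℕ → ℝ := fun z => Θ (trunc kk z) with hΦ
  have hΦw : Win kk Φ := by
    intro x x' h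
    simp only [hΦ, win_trunc kk x x' h]
  have hang : ∀ x, |ang V Rm Φ x| ≤ Real.pi / m := by
    intro x
    by_cases hs : Short V Rm x
    · obtain ⟨q, hq⟩ := hs
      rw [ang_eq Φ hq]
      exact hΘ1 _ _ _
    · rw [ang_eq_zero Φ hs, abs_zero]; positivity
  set B' : Sig κ → SL2 := fun x => B x * rot (ang V Rm Φ x) with hB'
  have hC' : ∀ x, lg (B' x) ≤ C := by
    intro x
    have := lg_mul (B x) (rot (ang V Rm Φ x))
    rw [lg_rot] at this
    have := hC x
    simp only [hB']; linarith
  have hwin : Win (k + (Rm + (ℓ + kk))) B' := by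
    intro x x' h
    simp only [hB']
    rw [hB x x' (h.mono (by omega)), win_ang hVw Rm Φ kk hΦw x x' (h.mono (by omega))]
  have hnsy : ∀ j : ℤ, ¬ Short V Rm (sh j y) := by
    rintro j ⟨q, hq, -⟩
    rw [sh_sh] at hq
    exact hVy _ hq
  refine ⟨B', _, hwin, ?_, ?_, M, hM1, ?_⟩
  · intro x
    have e : toEuc (B x) - toEuc (B' x) = toEuc (B x) * (1 - toEuc (rot (ang V Rm Φ x))) := by
      simp only [hB', toEuc_mul, mul_sub, mul_one]
    rw [e]
    have h2 := hrot _ ((hang x).trans hmr)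
    rw [norm_sub_rev] at h2
    calc _ ≤ ‖toEuc (B x)‖ * ‖1 - toEuc (rot (ang V Rm Φ x))‖ := norm_mul_le _ _
      _ ≤ K * ‖1 - toEuc (rot (ang V Rm Φ x))‖ := by gcongr; exact hK x
      _ < K * (ε / K) := by gcongr
      _ = ε := by field_simp
  · rw [← h1, coc_eq_cprod, coc_eq_cprod]
    apply cprod_congr
    intro j _
    simp only [hB', ang_eq_zero Φ (hnsy j), rot_zero, mul_one]
  · set Bd : Sig κ → Prop := Bad y k (m * n) W with hBd
    set NS : Sig κ → Prop := fun x => ¬ Short V Rm x with hNS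
    set g : Sig κ → ℝ := fun x => c1 * ind V x + 2 * C * ind Bd x + C * ind NS x with hg
    have hw1 : Win ℓ V := hVw
    have hw2 : Win (W + m * n + k) Bd := win_bad y k (m * n) W
    have hw3 : Win (Rm + ℓ) NS := by
      intro x x' h
      simp only [hNS, win_short hVw Rm x x' h]
    have hgc : Continuous g := by
      have := (win_ind hw1).continuous
      have := (win_ind hw2).continuous
      have := (win_ind hw3).continuous
      fun_prop
    have hg0 : ∀ x, 0 ≤ g x := by
      intro x
      have := ind_nonneg V x
      have := ind_nonneg Bd x
      have := ind_nonneg NS x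
      positivity
    have hlong : ∀ x, ¬ Short V Rm x → C ≤ g x := by
      intro x hx
      have a1 := ind_nonneg V x
      have a2 := ind_nonneg Bd x
      have a3 : ind NS x = 1 := ind_pos hx
      simp only [hg, a3, mul_one]
      have : 0 ≤ c1 * ind V x + 2 * C * ind Bd x := by positivity
      linarith
    have hblk : ∀ z R, 1 ≤ R → R ≤ Rm → V z → V (sh (R : ℕ) z) →
      (∀ s : ℕ, 0 < s → s < R → ¬ V (sh s z)) →
      lg (coc shift B' R z) ≤ ∑ s ∈ Finset.range R, g (sh s z) := by
      intro z R hR1 hR hz1 hz2 hz3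
      rw [coc_block Φ B z R hR hz1 hz2 hz3]
      have hag := agree_trunc kk z
      have e1 : cprod (fun i => B (sh i z) * rot (Φ z R i)) R =
          cprod (fun i => B (sh i (trunc kk z)) * rot (Θ (trunc kk z) R i)) R := by
        apply cprod_congr
        intro j hj
        have : B (sh j z) = B (sh j (trunc kk z)) := by
          apply hB
          apply agree_sh hag
          rw [abs_of_nonneg (by omega)]
          push_cast [hkk]
          have : (0 : ℤ) ≤ (m : ℤ) * n := by positivity
          omega
        rw [this]
      rw [e1]
      refine (hΘ2 (trunc kk z) R).trans ?_
      rw [ind_sum (Bad y k (m * n) W)]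
      have e2 : ∑ s ∈ Finset.range R, ind (Bad y k (m * n) W) (sh (s : ℤ) (trunc kk z)) =
          ∑ s ∈ Finset.range R, ind Bd (sh (s : ℤ) z) := by
        refine Finset.sum_congr rfl fun s hs => ?_
        rw [Finset.mem_range] at hs
        symm
        apply win_ind hw2
        apply agree_sh hag
        rw [abs_of_nonneg (by omega)]
        push_cast [hkk]
        omega
      rw [e2]
      have e3 : c1 ≤ ∑ s ∈ Finset.range R, c1 * ind V (sh (s : ℤ) z) := by
        have := Finset.single_le_sum (f := fun s : ℕ => c1 * ind V (sh (s : ℤ) z))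
          (fun s _ => mul_nonneg hc10 (ind_nonneg _ _)) (Finset.mem_range.2 hR1 : 0 ∈ Finset.range R)
        simp only [Nat.cast_zero, sh_zero, ind_pos hz1, mul_one] at this
        exact this
      have e4 : 0 ≤ ∑ s ∈ Finset.range R, C * ind NS (sh (s : ℤ) z) :=
        Finset.sum_nonneg fun s _ => mul_nonneg hC0 (ind_nonneg _ _)
      simp only [hg, Finset.sum_add_distrib]
      rw [← Finset.mul_sum (f := fun s : ℕ => ind Bd (sh (s : ℤ) z))]
      linarith
    have hest := est_all hC0 hC' g hg0 hlong hblk M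
    have hintg : ∫ x, lg (coc shift B' M x) ∂μ ≤ M * ∫ x, g x ∂μ + 2 * (C * Rm) := by
      have hgi : ∀ s : ℕ, Integrable (fun x => g (sh s x)) μ := fun s =>
        cont_integrable (hgc.comp (continuous_sh s))
      calc ∫ x, lg (coc shift B' M x) ∂μ
          ≤ ∫ x, (∑ s ∈ Finset.range M, g (sh s x) + 2 * (C * Rm)) ∂μ := by
            refine integral_mono_of_nonneg (Filter.Eventually.of_forall fun x => lg_nonneg _) ?_
              (Filter.Eventually.of_forall hest)
            exact (integrable_finsetSum _ fun s _ => hgi s).add (integrable_const _)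
        _ = ∑ s ∈ Finset.range M, ∫ x, g (sh s x) ∂μ + 2 * (C * Rm) := by
            rw [integral_add (integrable_finsetSum _ fun s _ => hgi s) (integrable_const _),
              integral_finsetSum _ fun s _ => hgi s]
            simp
        _ = _ := by
            congr 1
            have : ∀ s ∈ Finset.range M, ∫ x, g (sh s x) ∂μ = ∫ x, g x ∂μ := by
              intro s _
              have hmp := sh_preserving hμ (s : ℤ)
              rw [← integral_map (f := g) hmp.measurable.aemeasurable
                (by rw [hmp.map_eq]; exact (cont_integrable hgc).aestronglyMeasurable), hmp.map_eq]
            rw [Finset.sum_congr rfl this]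
            simp
    have hgint : ∫ x, g x ∂μ = c1 * μ.real {x | V x} + 2 * C * μ.real {x | Bd x} +
        C * μ.real {x | NS x} := by
      have i1 : Integrable (ind V) μ := cont_integrable (win_ind hw1).continuous
      have i2 : Integrable (ind Bd) μ := cont_integrable (win_ind hw2).continuous
      have i3 : Integrable (ind NS) μ := cont_integrable (win_ind hw3).continuous
      simp only [hg]
      have i12 : Integrable (fun x => c1 * ind V x + 2 * C * ind Bd x) μ :=
        (i1.const_mul _).add (i2.const_mul _)
      rw [integral_add i12 (i3.const_mul _),
        integral_add (i1.const_mul _) (i2.const_mul _), integral_const_mul, integral_const_mul,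
        integral_const_mul, integral_ind hw1, integral_ind hw2, integral_ind hw3]
    have aux : ∀ c t : ℝ, 0 ≤ c → 0 ≤ t → t < η / (4 * (c + 1)) → c * t ≤ η / 4 := by
      intro c t hc ht h
      rw [lt_div_iff₀ (by positivity)] at h
      nlinarith
    have b1 := aux c1 _ hc10 measureReal_nonneg hVm
    have b2 := aux (2 * C) _ (by positivity) measureReal_nonneg hW
    have b3 := aux C _ hC0 measureReal_nonneg hRm
    rw [inv_mul_lt_iff₀ hMpos]
    have : M * ∫ x, g x ∂μ ≤ M * (3 * (η / 4)) := by
      rw [hgint]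
      gcongr
      linarith
    linarith

end red2

/-! ### Baire category argument -/

section baire
variable {κ : ℕ}

abbrev CX (κ : ℕ) : Type := C(Sig κ, E2 →L[ℝ] E2)

def shiftC : C(Sig κ, Sig κ) := ⟨shift, continuous_shift⟩

def itr : ℕ → CX κ → CX κ
  | 0, _ => 1
  | n + 1, F => (itr n F).comp shiftC * F

lemma continuous_itr (n : ℕ) : Continuous (itr n : CX κ → CX κ) := by
  induction n with
  | zero => exact continuous_const
  | succ n ih => exact ((ContinuousMap.continuous_precomp shiftC).comp ih).mul continuous_id

def ofSL (B : Sig κ → SL2) (hB : Continuous B) : CX κ := ⟨fun x => toEuc (B x), continuous_toEuc.comp hB⟩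

lemma itr_ofSL (B : Sig κ → SL2) (hB : Continuous B) (n : ℕ) (x : Sig κ) :
    itr n (ofSL B hB) x = toEuc (coc shift B n x) := by
  induction n generalizing x with
  | zero => simp [itr, coc, toEuc_one]
  | succ n ih =>
    rw [coc, toEuc_mul, ← ih]
    rfl

lemma continuous_logmax : Continuous (fun T : E2 →L[ℝ] E2 => Real.log (max 1 ‖T‖)) :=
  Continuous.log (continuous_const.max continuous_norm) fun T => by
    have : (1 : ℝ) ≤ max 1 ‖T‖ := le_max_left _ _
    linarith

def logmax : C(E2 →L[ℝ] E2, ℝ) := ⟨_, continuous_logmax⟩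

def fun_int (μ : Measure (Sig κ)) (n : ℕ) (F : CX κ) : ℝ := ∫ x, logmax (itr n F x) ∂μ

lemma continuous_int (μ : Measure (Sig κ)) [IsProbabilityMeasure μ] :
    Continuous (fun f : C(Sig κ, ℝ) => ∫ x, f x ∂μ) := by
  have : LipschitzWith 1 (fun f : C(Sig κ, ℝ) => ∫ x, f x ∂μ) := by
    refine LipschitzWith.of_dist_le_mul fun f g => ?_
    rw [Real.dist_eq, ← integral_sub (cont_integrable f.continuous) (cont_integrable g.continuous)]
    have := norm_integral_le_of_norm_le_const (μ := μ) (f := fun x => f x - g x) (C := dist f g)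
      (Filter.Eventually.of_forall fun x => by
        rw [← dist_eq_norm]; exact ContinuousMap.dist_apply_le_dist x)
    simpa using this
  exact this.continuous

lemma continuous_fun_int (μ : Measure (Sig κ)) [IsProbabilityMeasure μ] (n : ℕ) :
    Continuous (fun_int μ n : CX κ → ℝ) :=
  (continuous_int μ).comp ((ContinuousMap.continuous_postcomp logmax).comp (continuous_itr n))

lemma fun_int_ofSL (μ : Measure (Sig κ)) (B : Sig κ → SL2) (hB : Continuous B) (n : ℕ) :
    fun_int μ n (ofSL B hB) = ∫ x, lg (coc shift B n x) ∂μ := by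
  unfold fun_int
  congr 1
  funext x
  rw [itr_ofSL]
  change Real.log (max 1 _) = _
  rw [max_eq_right (one_le_norm _), lg]

/-- locally constant cocycles with a periodic orbit of trivial monodromy -/
def good (κ : ℕ) : Set (CX κ) :=
  {F | ∃ (B : Sig κ → SL2) (k : ℕ) (hB : Win k B) (y : Sig κ) (n : ℕ), 1 ≤ n ∧ sh n y = y ∧
    coc shift B n y = 1 ∧ F = ofSL B hB.continuous}

lemma exists_SL_of_closure (F : CX κ) (hF : F ∈ closure (good κ)) :
    ∃ (B : Sig κ → SL2) (hB : Continuous B), F = ofSL B hB := by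
  have hsymm : Continuous (fun T : E2 →L[ℝ] E2 => (Matrix.toEuclideanCLM (𝕜 := ℝ) (n := Fin 2)).symm T) := by
    exact LinearMap.continuous_of_finiteDimensional
      ((Matrix.toEuclideanCLM (𝕜 := ℝ) (n := Fin 2)).symm.toAlgEquiv.toLinearMap)
  have hdet : ∀ x, ((Matrix.toEuclideanCLM (𝕜 := ℝ) (n := Fin 2)).symm (F x)).det = 1 := by
    have hcl : IsClosed {F : CX κ | ∀ x, ((Matrix.toEuclideanCLM (𝕜 := ℝ) (n := Fin 2)).symm (F x)).det = 1} := by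
      rw [show {F : CX κ | ∀ x, ((Matrix.toEuclideanCLM (𝕜 := ℝ) (n := Fin 2)).symm (F x)).det = 1} =
        ⋂ x, {F : CX κ | ((Matrix.toEuclideanCLM (𝕜 := ℝ) (n := Fin 2)).symm (F x)).det = 1} by
          ext; simp]
      refine isClosed_iInter fun x => isClosed_eq ?_ continuous_const
      exact (hsymm.comp (continuous_eval_const x)).matrix_det
    refine closure_minimal ?_ hcl hF
    rintro _ ⟨B, k, hB, y, n, -, -, -, rfl⟩ x
    change ((Matrix.toEuclideanCLM (𝕜 := ℝ) (n := Fin 2)).symm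
      (Matrix.toEuclideanCLM (𝕜 := ℝ) (n := Fin 2) (B x : Mat2))).det = 1
    rw [StarAlgEquiv.symm_apply_apply]
    exact (B x).2
  refine ⟨fun x => ⟨(Matrix.toEuclideanCLM (𝕜 := ℝ) (n := Fin 2)).symm (F x), hdet x⟩, ?_, ?_⟩
  · refine continuous_SL2_iff.2 ?_
    exact hsymm.comp F.continuous
  · ext1 x
    change F x = Matrix.toEuclideanCLM (𝕜 := ℝ) (n := Fin 2) ((Matrix.toEuclideanCLM (𝕜 := ℝ) (n := Fin 2)).symm (F x))
    rw [StarAlgEquiv.apply_symm_apply]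

variable {p : Fin κ → ℝ} {μ : Measure (Sig κ)}

lemma baire_gen {Y : Type*} [MetricSpace Y] [CompleteSpace Y] (S : Set Y) (U : ℕ → Set Y)
    (hU : ∀ k, IsOpen (U k))
    (hd : ∀ k, ∀ G ∈ S, ∀ r : ℝ, 0 < r → ∃ G' ∈ S, G' ∈ U k ∧ dist G G' < r)
    (F : Y) (hF : F ∈ S) (ε : ℝ) (hε : 0 < ε) :
    ∃ F' ∈ closure S, dist F' F < ε ∧ ∀ k, F' ∈ U k := by
  have : CompleteSpace (closure S) := isClosed_closure.completeSpace_coe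
  have hO : ∀ k, IsOpen (Subtype.val ⁻¹' (U k) : Set (closure S)) := fun k =>
    (hU k).preimage continuous_subtype_val
  have hD : ∀ k, Dense (Subtype.val ⁻¹' (U k) : Set (closure S)) := by
    intro k
    rw [Metric.dense_iff]
    rintro ⟨G, hG⟩ r hr
    obtain ⟨G1, hG1, hd1⟩ := Metric.mem_closure_iff.1 hG (r / 2) (by positivity)
    obtain ⟨G2, hG2, hu, hd2⟩ := hd k G1 hG1 (r / 2) (by positivity)
    refine ⟨⟨G2, subset_closure hG2⟩, ?_, hu⟩
    rw [Metric.mem_ball, dist_comm, Subtype.dist_eq]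
    have := dist_triangle G G1 G2
    simp only
    linarith
  have hdense := dense_iInter_of_isOpen_nat hO hD
  obtain ⟨⟨F', hF'⟩, hb, hi⟩ := Metric.dense_iff.1 hdense ⟨F, subset_closure hF⟩ ε hε
  refine ⟨F', hF', ?_, ?_⟩
  · rw [Metric.mem_ball, Subtype.dist_eq] at hb
    exact hb
  · intro k
    exact Set.mem_iInter.1 hi k

set_option synthInstance.maxHeartbeats 400000 in
set_option maxHeartbeats 1000000 in
lemma baire_step (hκ : 2 ≤ κ) (hp : ∀ i, 0 < p i) (hp1 : ∑ i, p i = 1) (hμ : IsBernoulli p μ)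
    (F : CX κ) (hF : F ∈ good κ) (ε : ℝ) (hε : 0 < ε) :
    ∃ F' ∈ closure (good κ), dist F' F < ε ∧ ∀ k : ℕ, ∃ n : ℕ, 1 ≤ n ∧
      (n : ℝ)⁻¹ * fun_int μ n F' < 1 / ((k : ℝ) + 1) := by
  have := hμ.1
  refine baire_gen (good κ)
    (fun k => {G | ∃ n : ℕ, 1 ≤ n ∧ (n : ℝ)⁻¹ * fun_int μ n G < 1 / ((k : ℝ) + 1)}) ?_ ?_ F hF ε hε
  · intro k
    have : {G : CX κ | ∃ n : ℕ, 1 ≤ n ∧ (n : ℝ)⁻¹ * fun_int μ n G < 1 / ((k : ℝ) + 1)} =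
        ⋃ n : ℕ, {G | 1 ≤ n ∧ (n : ℝ)⁻¹ * fun_int μ n G < 1 / ((k : ℝ) + 1)} := by
      ext G
      rw [Set.mem_iUnion]
      rfl
    rw [this]
    refine isOpen_iUnion fun n => ?_
    by_cases hn : 1 ≤ n
    · simp only [hn, true_and]
      exact isOpen_lt (continuous_const.mul (continuous_fun_int μ n)) continuous_const
    · simp [hn]
  · rintro k _ ⟨B, kk, hB, y, n, hn, hy, h1, rfl⟩ r hr
    obtain ⟨B', k', hB', hd, h1', M, hM, hintg⟩ := reduction hκ hp hp1 hμ B kk hB y n hn hy h1 r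
      (1 / ((k : ℝ) + 1)) hr (by positivity)
    refine ⟨ofSL B' hB'.continuous, ⟨B', k', hB', y, n, hn, hy, h1', rfl⟩, ⟨M, hM, ?_⟩, ?_⟩
    · rw [fun_int_ofSL]
      exact hintg
    · rw [ContinuousMap.dist_lt_iff hr]
      intro x
      rw [dist_eq_norm]
      exact hd x

end baire

theorem bochi_mane_aux {κ : ℕ} (hκ : 2 ≤ κ) (p : Fin κ → ℝ)
    (hp : ∀ i, 0 < p i) (hp1 : ∑ i, p i = 1)
    (μ : Measure (Sig κ)) (hμ : IsBernoulli p μ)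
    (A : Sig κ → SL2) (hA : Continuous A)
    (hNUH : ¬ UniformlyHyperbolic A) :
    ∀ ε : ℝ, 0 < ε → ∃ B : Sig κ → SL2, Continuous B ∧
      (∀ x, opNorm ((A x : Mat2) - (B x : Mat2)) < ε) ∧ lyap μ B = 0 := by
  intro ε hε
  obtain ⟨B0, k, y, n, hB0, hd0, hn, hy, h1⟩ := closing hκ A hA hNUH (ε / 2) (by positivity)
  obtain ⟨F, hF, hdF, hO⟩ := baire_step hκ hp hp1 hμ (ofSL B0 hB0.continuous)
    ⟨B0, k, hB0, y, n, hn, hy, h1, rfl⟩ (ε / 2) (by positivity)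
  obtain ⟨B, hB, rfl⟩ := exists_SL_of_closure F hF
  refine ⟨B, hB, ?_, ?_⟩
  · intro x
    rw [opNorm_sub]
    have h2 : ‖toEuc (B0 x) - toEuc (B x)‖ < ε / 2 := by
      rw [ContinuousMap.dist_lt_iff (by positivity)] at hdF
      have := hdF x
      rw [dist_comm, dist_eq_norm] at this
      exact this
    have h3 := hd0 x
    have h4 := norm_sub_le_norm_sub_add_norm_sub (toEuc (A x)) (toEuc (B0 x)) (toEuc (B x))
    linarith
  · have hval : ∀ m : ℕ, ∫ x, Real.log (opNorm ((cocycleN B m x : SL2) : Mat2)) ∂μ =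
        fun_int μ m (ofSL B hB) := by
      intro m
      rw [fun_int_ofSL]
      congr 1
      funext x
      rw [opNorm_eq, cocycleN_eq, lg]
    have hnn : ∀ m : {m : ℕ // 0 < m}, 0 ≤ (((m : ℕ) : ℝ))⁻¹ *
        ∫ x, Real.log (opNorm ((cocycleN B (m : ℕ) x : SL2) : Mat2)) ∂μ := by
      intro m
      rw [hval, fun_int_ofSL]
      exact mul_nonneg (by positivity) (integral_nonneg fun x => lg_nonneg _)
    have : Nonempty {m : ℕ // 0 < m} := ⟨⟨1, one_pos⟩⟩
    apply le_antisymm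
    · apply le_of_forall_pos_lt_add
      intro δ hδ
      obtain ⟨k, hk⟩ := exists_nat_one_div_lt hδ
      obtain ⟨m, hm, hlt⟩ := hO k
      rw [← hval] at hlt
      have hle := ciInf_le (f := fun m : {m : ℕ // 0 < m} => (((m : ℕ) : ℝ))⁻¹ *
        ∫ x, Real.log (opNorm ((cocycleN B (m : ℕ) x : SL2) : Mat2)) ∂μ)
        ⟨0, by rintro _ ⟨m, rfl⟩; exact hnn m⟩ ⟨m, hm⟩
      unfold lyap
      simp only at hle
      linarith
    · exact le_ciInf hnn

/-- **Bochi–Mañé theorem.** If a continuous cocycle `A : Σ → SL₂(ℝ)` is not uniformly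
hyperbolic and has positive Lyapunov exponent, then arbitrarily `C⁰`-close to `A` there
are continuous cocycles with zero Lyapunov exponent. -/
theorem bochi_mane {κ : ℕ} (hκ : 2 ≤ κ) (p : Fin κ → ℝ)
    (hp : ∀ i, 0 < p i) (hp1 : ∑ i, p i = 1)
    (μ : Measure (Sig κ)) (hμ : IsBernoulli p μ)
    (A : Sig κ → SL2) (hA : Continuous A)
    (hNUH : ¬ UniformlyHyperbolic A) (hL : 0 < lyap μ A) :
    ∀ ε : ℝ, 0 < ε → ∃ B : Sig κ → SL2, Continuous B ∧
      (∀ x, opNorm ((A x : Mat2) - (B x : Mat2)) < ε) ∧ lyap μ B = 0 := by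
  exact bochi_mane_aux hκ p hp hp1 μ hμ A hA hNUH
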